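/- There exists n₀ such that the following holds for every integer n ≥ n₀: if n can be factored as n = (N − a)(N + b) for some integers N, a, b with 0 ≤ a ≤ b ≤ exp((log n)^{2/7}), then the number of divisors d of n satisfying √n − n^{1/4}·(log n)^{1/14} ≤ d ≤ √n + n^{1/4}·(log n)^{1/14} is at most eighteen. -/

import Mathlib

open Real

theorem exists_iteratedDeriv_eq_zero_of_strictMono (n : ℕ) : ∀ (f : ℝ → ℝ), ContDiff ℝ (⊤ : ℕ∞) f →
    ∀ z : ℕ → ℝ, (∀ i < n, z i < z (i + 1)) → (∀ i ≤ n, f (z i) = 0) →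
    ∃ c ∈ Set.Icc (z 0) (z n), iteratedDeriv n f c = 0 := by
  induction n with
  | zero =>
    intro f _ z _ h0
    exact ⟨z 0, by simp, by simpa using h0 0 le_rfl⟩
  | succ n ih =>
    intro f hf z hz h0
    have rolle : ∀ i, ∃ c, i ≤ n → c ∈ Set.Ioo (z i) (z (i + 1)) ∧ deriv f c = 0 := by
      intro i
      by_cases hi : i ≤ n
      · obtain ⟨c, hc, hc0⟩ := exists_deriv_eq_zero (hz i (by omega))
          hf.continuous.continuousOn ((h0 i (by omega)).trans (h0 (i + 1) (by omega)).symm)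
        exact ⟨c, fun _ => ⟨hc, hc0⟩⟩
      · exact ⟨0, fun h => absurd h hi⟩
    choose w hw using rolle
    have hf' : ContDiff ℝ (⊤ : ℕ∞) (deriv f) := (contDiff_infty_iff_deriv.1 hf).2
    obtain ⟨c, hc, hc0⟩ := ih (deriv f) hf' w
      (fun i hi => (hw i hi.le).1.2.trans (hw (i + 1) hi).1.1) (fun i hi => (hw i hi).2)
    refine ⟨c, ⟨(hw 0 (by omega)).1.1.le.trans hc.1, hc.2.trans (hw n le_rfl).1.2.le⟩, ?_⟩
    rw [iteratedDeriv_succ', hc0]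

theorem exists_iteratedDeriv_eq_zero_of_card {f : ℝ → ℝ} (hf : ContDiff ℝ (⊤ : ℕ∞) f) {n : ℕ}
    {S : Finset ℝ} (hS : S.card = n + 1) {M : ℝ} (hM : ∀ x ∈ S, |x| ≤ M) (h0 : ∀ x ∈ S, f x = 0) :
    ∃ c, |c| ≤ M ∧ iteratedDeriv n f c = 0 := by
  let z : ℕ → ℝ := fun i => if h : i < n + 1 then S.orderEmbOfFin hS ⟨i, h⟩ else 0
  have hz : ∀ i ≤ n, z i ∈ S := by
    intro i hi
    simp only [z, dif_pos (Nat.lt_succ_of_le hi)]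
    exact S.orderEmbOfFin_mem hS _
  obtain ⟨c, hc, hc0⟩ := exists_iteratedDeriv_eq_zero_of_strictMono n f hf z
    (by
      intro i hi
      simp only [z, dif_pos (show i < n + 1 by omega), dif_pos (show i + 1 < n + 1 by omega)]
      exact (S.orderEmbOfFin hS).strictMono (by simp))
    (fun i hi => h0 _ (hz i hi))
  refine ⟨c, abs_le.2 ⟨?_, ?_⟩, hc0⟩
  · exact (abs_le.1 (hM _ (hz 0 (by omega)))).1.trans hc.1
  · exact hc.2.trans (abs_le.1 (hM _ (hz n le_rfl))).2

theorem iteratedDeriv_eval (P : Polynomial ℝ) (n : ℕ) :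
    iteratedDeriv n (fun x => P.eval x) = fun x => (Polynomial.derivative^[n] P).eval x := by
  induction n generalizing P with
  | zero => simp
  | succ n ih =>
    rw [iteratedDeriv_succ']
    have : deriv (fun x => P.eval x) = fun x => (Polynomial.derivative P).eval x := by
      ext x; simp
    rw [this, ih, Function.iterate_succ_apply]

theorem iterate_derivative_of_monic {P : Polynomial ℝ} (hP : P.Monic) :
    Polynomial.derivative^[P.natDegree] P = Polynomial.C (P.natDegree.factorial : ℝ) := by
  have h := Polynomial.eq_C_of_natDegree_le_zero (p := Polynomial.derivative^[P.natDegree] P)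
    (by have := Polynomial.natDegree_iterate_derivative P P.natDegree; omega)
  rw [h, Polynomial.coeff_iterate_derivative]
  simp [hP, Nat.descFactorial_self]

/-- Lagrange interpolation with remainder, at nodes which are `1`-separated. -/
theorem abs_le_of_small_at_nodes {f : ℝ → ℝ} (hf : ContDiff ℝ (⊤ : ℕ∞) f) (S : Finset ℝ) {M D δ : ℝ}
    (hM1 : 1 ≤ M) (hM : ∀ x ∈ S, |x| ≤ M) (hsep : ∀ x ∈ S, ∀ y ∈ S, x ≠ y → 1 ≤ |x - y|)
    (hD : ∀ x, |x| ≤ M → |iteratedDeriv S.card f x| ≤ D) (hδ : ∀ x ∈ S, |f x| ≤ δ)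
    {x₀ : ℝ} (hx₀ : |x₀| ≤ M) :
    |f x₀| ≤ D * (2 * M) ^ S.card / (S.card).factorial + S.card * δ * (2 * M) ^ S.card := by
  have hD0 : 0 ≤ D := (abs_nonneg _).trans (hD x₀ hx₀)
  have hpow : ∀ k, k ≤ S.card → (2 * M) ^ k ≤ (2 * M) ^ S.card :=
    fun k hk => pow_le_pow_right₀ (by linarith) hk
  have hdist : ∀ x ∈ S, |x₀ - x| ≤ 2 * M := fun x hx =>
    (abs_sub _ _).trans (by linarith [hM x hx])
  by_cases hmem : x₀ ∈ S
  · have h1 : (1 : ℝ) ≤ S.card := by exact_mod_cast Finset.card_pos.2 ⟨_, hmem⟩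
    have h2 : (1 : ℝ) ≤ (2 * M) ^ S.card := one_le_pow₀ (by linarith)
    have h3 := hδ x₀ hmem
    have h4 : 0 ≤ δ := (abs_nonneg _).trans h3
    have h5 : δ ≤ S.card * δ * (2 * M) ^ S.card := by
      calc δ = 1 * δ * 1 := by ring
        _ ≤ _ := by gcongr
    have : 0 ≤ D * (2 * M) ^ S.card / (S.card).factorial := by positivity
    linarith
  set p := Lagrange.interpolate S id f with hp
  set w := Lagrange.nodal S (id : ℝ → ℝ) with hw
  have hwx : w.eval x₀ ≠ 0 := by
    rw [hw, Lagrange.eval_nodal, Finset.prod_ne_zero_iff]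
    intro x hx h
    exact hmem (by rw [sub_eq_zero.1 h]; exact hx)
  set κ := (f x₀ - p.eval x₀) / w.eval x₀ with hκ
  have hinj : Set.InjOn (id : ℝ → ℝ) S := Function.injective_id.injOn
  have hpd : p.degree < S.card := Lagrange.degree_interpolate_lt _ hinj
  have hcp : ∀ P : Polynomial ℝ, ContDiff ℝ (⊤ : ℕ∞) (fun x => P.eval x) := by
    intro P
    simp only [Polynomial.eval_eq_sum_range]
    fun_prop
  have hder : ∃ c, |c| ≤ M ∧
      iteratedDeriv S.card (fun x => f x - (p + Polynomial.C κ * w).eval x) c = 0 := by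
    refine exists_iteratedDeriv_eq_zero_of_card (S := insert x₀ S) (hf.sub (hcp _))
      (Finset.card_insert_of_notMem hmem) ?_ ?_
    · intro x hx
      rcases Finset.mem_insert.1 hx with rfl | hx
      exacts [hx₀, hM x hx]
    · intro x hx
      rcases Finset.mem_insert.1 hx with rfl | hx
      · simp only [Polynomial.eval_add, Polynomial.eval_mul, Polynomial.eval_C, hκ]
        field_simp
        ring
      · have h1 : p.eval x = f x := Lagrange.eval_interpolate_at_node (v := id) f hinj hx
        have h2 : w.eval x = 0 := Lagrange.eval_nodal_at_node (v := id) hx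
        simp [h1, h2]
  obtain ⟨c, hcM, hc⟩ := hder
  have hsub : iteratedDeriv S.card (fun x => f x - (p + Polynomial.C κ * w).eval x) c
      = iteratedDeriv S.card f c -
        iteratedDeriv S.card (fun x => (p + Polynomial.C κ * w).eval x) c :=
    iteratedDeriv_sub (hf.contDiffAt.of_le (mod_cast le_top))
      ((hcp _).contDiffAt.of_le (mod_cast le_top))
  have hwn : w.natDegree = S.card := Lagrange.natDegree_nodal
  have hwd : Polynomial.derivative^[S.card] w = Polynomial.C (S.card.factorial : ℝ) := by
    have := iterate_derivative_of_monic (Lagrange.nodal_monic (s := S) (v := (id : ℝ → ℝ)))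
    rwa [← hw, hwn] at this
  have hpd0 : Polynomial.derivative^[S.card] p = 0 :=
    Polynomial.iterate_derivative_eq_zero_of_degree_lt hpd
  have hκeq : iteratedDeriv S.card f c = κ * S.card.factorial := by
    rw [hsub, iteratedDeriv_eval] at hc
    simp only [iterate_map_add, Polynomial.iterate_derivative_C_mul, hwd, hpd0,
      Polynomial.eval_add, Polynomial.eval_mul, Polynomial.eval_C, Polynomial.eval_zero] at hc
    linarith
  have hfac : (0 : ℝ) < S.card.factorial := by exact_mod_cast Nat.factorial_pos _
  have hκle : |κ| ≤ D / S.card.factorial := by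
    rw [le_div_iff₀ hfac, ← abs_of_pos hfac, ← abs_mul, ← hκeq]
    exact hD c hcM
  have hwle : |w.eval x₀| ≤ (2 * M) ^ S.card := by
    rw [hw, Lagrange.eval_nodal, Finset.abs_prod]
    exact (Finset.prod_le_prod (fun _ _ => abs_nonneg _) hdist).trans_eq (by simp)
  have hbasis : ∀ i ∈ S, |(Lagrange.basis S id i).eval x₀| ≤ (2 * M) ^ S.card := by
    intro i hi
    rw [Lagrange.basis, Polynomial.eval_prod, Finset.abs_prod]
    refine (Finset.prod_le_prod (g := fun _ => 2 * M) (fun _ _ => abs_nonneg _) ?_).trans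
      ((Finset.prod_const _).trans_le (hpow _ (Finset.card_le_card (Finset.erase_subset _ _))))
    intro j hj
    obtain ⟨hji, hj⟩ := Finset.mem_erase.1 hj
    have h1 := hsep i hi j hj hji.symm
    simp only [Lagrange.basisDivisor, Polynomial.eval_mul, Polynomial.eval_C, Polynomial.eval_sub,
      Polynomial.eval_X, id, abs_mul, abs_inv]
    calc |i - j|⁻¹ * |x₀ - j| ≤ 1 * (2 * M) := by
          gcongr
          · exact inv_le_one_of_one_le₀ h1
          · exact hdist j hj
      _ = 2 * M := one_mul _
  have hple : |p.eval x₀| ≤ S.card * δ * (2 * M) ^ S.card := by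
    rw [hp, Lagrange.interpolate_apply, Polynomial.eval_finsetSum]
    refine (Finset.abs_sum_le_sum_abs _ _).trans ?_
    rw [mul_assoc, ← nsmul_eq_mul]
    refine Finset.sum_le_card_nsmul _ _ _ ?_
    intro i hi
    rw [Polynomial.eval_mul, Polynomial.eval_C, abs_mul]
    have h3 := hδ i hi
    have h4 : 0 ≤ δ := (abs_nonneg _).trans h3
    exact mul_le_mul h3 (hbasis i hi) (abs_nonneg _) h4
  have hfx : f x₀ = p.eval x₀ + κ * w.eval x₀ := by
    rw [hκ]; field_simp; ring
  rw [hfx]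
  refine (abs_add_le _ _).trans ?_
  rw [abs_mul, add_comm]
  refine add_le_add ?_ hple
  calc |κ| * |w.eval x₀| ≤ D / S.card.factorial * (2 * M) ^ S.card := by gcongr
    _ = _ := by ring

theorem abs_iteratedDeriv_pow_mul_exp_le {i K : ℕ} (hi : i ≤ K) {θ M T x : ℝ} (hM1 : 1 ≤ M)
    (hx : |x| ≤ M) (hT : |θ| * M ≤ T) (n : ℕ) :
    M ^ n * |iteratedDeriv n (fun y => y ^ i * exp (θ * y)) x| ≤
      M ^ K * (K + T) ^ n * exp T := by
  have hM0 : 0 ≤ M := by linarith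
  have hT0 : 0 ≤ T := (by positivity : 0 ≤ |θ| * M).trans hT
  rw [iteratedDeriv_fun_mul (by fun_prop) (by fun_prop), add_pow, Finset.mul_sum, Finset.sum_mul]
  refine (mul_le_mul_of_nonneg_left (Finset.abs_sum_le_sum_abs _ _) (by positivity)).trans ?_
  rw [Finset.mul_sum]
  refine Finset.sum_le_sum fun k hk => ?_
  have hkn : k ≤ n := Nat.lt_succ_iff.1 (Finset.mem_range.1 hk)
  rw [iteratedDeriv_pow, iteratedDeriv_exp_const_mul]
  have hexp : exp (θ * x) ≤ exp T := by
    rw [exp_le_exp]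
    calc θ * x ≤ |θ * x| := le_abs_self _
      _ = |θ| * |x| := abs_mul _ _
      _ ≤ |θ| * M := by gcongr
      _ ≤ T := hT
  have hpow : M ^ (n - k) * |θ| ^ (n - k) ≤ T ^ (n - k) := by
    rw [← mul_pow, mul_comm]; gcongr
  have hdesc : M ^ k * (i.descFactorial k * |x| ^ (i - k)) ≤ M ^ K * (K : ℝ) ^ k := by
    rcases lt_or_ge i k with h | h
    · rw [Nat.descFactorial_of_lt h]; simp; positivity
    · have h1 : (i.descFactorial k : ℝ) ≤ (K : ℝ) ^ k := by
        exact_mod_cast (Nat.descFactorial_le_pow i k).trans (Nat.pow_le_pow_left hi k)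
      calc M ^ k * (i.descFactorial k * |x| ^ (i - k))
          ≤ M ^ k * ((K : ℝ) ^ k * M ^ (i - k)) := by gcongr
        _ = M ^ i * (K : ℝ) ^ k := by
            rw [← pow_mul_pow_sub M h]; ring
        _ ≤ M ^ K * (K : ℝ) ^ k := by gcongr
  simp only [abs_mul, abs_pow, Nat.abs_cast, abs_exp]
  calc M ^ n * (n.choose k * (i.descFactorial k * |x| ^ (i - k)) * (|θ| ^ (n - k) * exp (θ * x)))
      = (M ^ k * (i.descFactorial k * |x| ^ (i - k))) * (M ^ (n - k) * |θ| ^ (n - k))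
          * exp (θ * x) * n.choose k := by
        rw [← pow_mul_pow_sub M hkn]; ring
    _ ≤ (M ^ K * (K : ℝ) ^ k) * T ^ (n - k) * exp T * n.choose k := by gcongr
    _ = _ := by ring

/-- A polynomial in `x` and `exp (φ x)` which is small at many integers is small at all
integers in the same range. -/
theorem abs_expPoly_le {K L : ℕ} (p : ℕ → ℕ → ℝ) {B φ M T δ : ℝ} (hM1 : 1 ≤ M)
    (hp : ∀ i < K, ∀ j < L, |p i j| ≤ B) (hT : L * |φ| * M ≤ T) (S : Finset ℤ)
    (hS : ∀ x ∈ S, |(x : ℝ)| ≤ M) (hcard : 2 * (K + T) * exp 3 ≤ S.card)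
    (hδ : ∀ x ∈ S, |∑ i ∈ Finset.range K, ∑ j ∈ Finset.range L,
      p i j * ((x : ℝ) ^ i * exp (j * φ * x))| ≤ δ) (x₀ : ℤ) (hx₀ : |(x₀ : ℝ)| ≤ M) :
    |∑ i ∈ Finset.range K, ∑ j ∈ Finset.range L, p i j * ((x₀ : ℝ) ^ i * exp (j * φ * x₀))| ≤
      K * L * B * M ^ K * exp T * exp (-(2 * S.card)) + S.card * δ * (2 * M) ^ S.card := by
  classical
  set F : ℝ → ℝ := fun x => ∑ i ∈ Finset.range K, ∑ j ∈ Finset.range L,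
    p i j * (x ^ i * exp (j * φ * x)) with hF
  have hT0 : 0 ≤ T := (by positivity : 0 ≤ L * |φ| * M).trans hT
  have hFc : ContDiff ℝ (⊤ : ℕ∞) F := by fun_prop
  set S' : Finset ℝ := S.image (fun x : ℤ => (x : ℝ)) with hS'
  have hcard' : S'.card = S.card := Finset.card_image_of_injective _ Int.cast_injective
  set n := S.card with hn
  have hderiv : ∀ x, |x| ≤ M → |iteratedDeriv n F x| ≤
      K * L * B * M ^ K * exp T * (K + T) ^ n / M ^ n := by
    intro x hx
    rw [le_div_iff₀ (by positivity), mul_comm, hF, iteratedDeriv_fun_sum (fun _ _ => by fun_prop)]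
    calc M ^ n * |∑ i ∈ Finset.range K, iteratedDeriv n (fun z => ∑ j ∈ Finset.range L,
          p i j * (z ^ i * exp (j * φ * z))) x|
        ≤ M ^ n * ∑ i ∈ Finset.range K, ∑ j ∈ Finset.range L,
            |p i j| * |iteratedDeriv n (fun z => z ^ i * exp (j * φ * z)) x| := by
          gcongr
          refine (Finset.abs_sum_le_sum_abs _ _).trans (Finset.sum_le_sum fun i _ => ?_)
          rw [iteratedDeriv_fun_sum (fun _ _ => by fun_prop)]
          refine (Finset.abs_sum_le_sum_abs _ _).trans_eq (Finset.sum_congr rfl fun j _ => ?_)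
          rw [iteratedDeriv_const_mul_field, abs_mul]
      _ = ∑ i ∈ Finset.range K, ∑ j ∈ Finset.range L,
            |p i j| * (M ^ n * |iteratedDeriv n (fun z => z ^ i * exp (j * φ * z)) x|) := by
          simp only [Finset.mul_sum]
          exact Finset.sum_congr rfl fun i _ => Finset.sum_congr rfl fun j _ => by ring
      _ ≤ ∑ i ∈ Finset.range K, ∑ j ∈ Finset.range L, B * (M ^ K * (K + T) ^ n * exp T) := by
          refine Finset.sum_le_sum fun i hi => Finset.sum_le_sum fun j hj => ?_
          rw [Finset.mem_range] at hi hj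
          have hB := hp i hi j hj
          have hB0 : 0 ≤ B := (abs_nonneg _).trans hB
          refine mul_le_mul hB (abs_iteratedDeriv_pow_mul_exp_le hi.le hM1 hx ?_ n)
            (by positivity) hB0
          rw [abs_mul, Nat.abs_cast]
          refine le_trans ?_ hT
          gcongr
      _ = K * L * B * M ^ K * exp T * (K + T) ^ n := by
          simp only [Finset.sum_const, Finset.card_range, nsmul_eq_mul]; ring
  have main := abs_le_of_small_at_nodes hFc S' (δ := δ) hM1
    (by simpa [hS'] using hS)
    (by
      simp only [hS', Finset.mem_image]
      rintro _ ⟨x, -, rfl⟩ _ ⟨y, -, rfl⟩ hxy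
      have : x - y ≠ 0 := fun h => hxy (by rw [sub_eq_zero.1 h])
      exact_mod_cast Int.one_le_abs this)
    (by rw [hcard']; exact hderiv)
    (by simpa [hS'] using hδ) hx₀
  rw [hcard'] at main
  refine main.trans (add_le_add ?_ le_rfl)
  have hfac : (0 : ℝ) < n.factorial := by exact_mod_cast Nat.factorial_pos _
  have hsmall : (2 * (K + T)) ^ n / n.factorial ≤ exp (-(2 * n)) := by
    have h1 : 2 * (K + T) ≤ n * exp (-3) := by
      rw [exp_neg, ← div_eq_mul_inv, le_div_iff₀ (exp_pos _)]; exact hcard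
    calc (2 * (K + T)) ^ n / n.factorial ≤ (n * exp (-3)) ^ n / n.factorial := by gcongr
      _ = (n : ℝ) ^ n / n.factorial * exp (-(3 * n)) := by
          rw [mul_pow, ← exp_nat_mul]; ring_nf
      _ ≤ exp n * exp (-(3 * n)) := by
          gcongr; exact pow_div_factorial_le_exp _ (by positivity) n
      _ = exp (-(2 * n)) := by rw [← exp_add]; ring_nf
  rcases Nat.eq_zero_or_pos (K * L) with hKL | hKL
  · have : (K : ℝ) * L = 0 := by exact_mod_cast hKL
    simp [this]
  have hK : 0 < K := Nat.pos_of_mul_pos_right hKL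
  have hL : 0 < L := Nat.pos_of_mul_pos_left hKL
  have hB0 : 0 ≤ B := (abs_nonneg _).trans (hp 0 hK 0 hL)
  calc K * L * B * M ^ K * exp T * (K + T) ^ n / M ^ n * (2 * M) ^ n / n.factorial
      = K * L * B * M ^ K * exp T * ((2 * (K + T)) ^ n / n.factorial) := by
        rw [mul_pow, mul_pow]; field_simp
    _ ≤ _ := by gcongr

theorem Polynomial.natDegree_det_le {n : Type*} [Fintype n] [DecidableEq n] {R : Type*} [CommRing R]
    (A : Matrix n n (Polynomial R)) {d : ℕ} (hA : ∀ i j, (A i j).natDegree ≤ d) :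
    A.det.natDegree ≤ Fintype.card n * d := by
  rw [Matrix.det_apply']
  refine Polynomial.natDegree_sum_le_of_forall_le _ _ fun σ _ => ?_
  refine Polynomial.natDegree_mul_le.trans ?_
  rw [Polynomial.natDegree_intCast, zero_add]
  refine (Polynomial.natDegree_prod_le _ _).trans ?_
  exact (Finset.sum_le_card_nsmul _ _ d fun i _ => hA _ _).trans (by simp)

theorem Polynomial.coeff_det_of_natDegree_le {n : Type*} [Fintype n] [DecidableEq n] {R : Type*}
    [CommRing R] (A : Matrix n n (Polynomial R)) {d : ℕ} (hA : ∀ i j, (A i j).natDegree ≤ d) :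
    A.det.coeff (Fintype.card n * d) = (A.map fun q => q.coeff d).det := by
  rw [Matrix.det_apply', Matrix.det_apply', Polynomial.finsetSum_coeff]
  refine Finset.sum_congr rfl fun σ _ => ?_
  rw [Polynomial.coeff_intCast_mul]
  congr 1
  exact Polynomial.coeff_prod_of_natDegree_le _ _ d fun i _ => hA _ _

/-- A zero estimate on the product of the additive and the multiplicative group. -/
theorem eq_zero_of_vanishing {K L : ℕ} (p : ℕ → ℕ → ℝ) {θ : ℝ} (hθ0 : 0 < θ) (hθ1 : θ ≠ 1)
    (S : Finset ℝ) (g : ℝ → ℝ) (hg : ∀ x ∈ S, g x ≠ 0) (hS : K * L < S.card)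
    (hvan : ∀ x ∈ S, ∀ t < L, ∑ i ∈ Finset.range K, ∑ j ∈ Finset.range L,
      p i j * ((x + t) ^ i * (θ ^ t * g x) ^ j) = 0) :
    ∀ i < K, ∀ j < L, p i j = 0 := by
  classical
  by_contra! hne
  obtain ⟨i₀, hi₀, j₀, hj₀, hp₀⟩ := hne
  set Q : ℕ → Polynomial ℝ := fun j => ∑ i ∈ Finset.range K, Polynomial.monomial i (p i j) with hQ
  have hQc : ∀ i < K, ∀ j, (Q j).coeff i = p i j := by
    intro i hi j
    simp [hQ, Polynomial.coeff_monomial, hi]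
  have hQe : ∀ j x, (Q j).eval x = ∑ i ∈ Finset.range K, p i j * x ^ i := by
    intro j x; simp [hQ, Polynomial.eval_finsetSum]
  have hQd : ∀ j, (Q j).natDegree ≤ K := fun j =>
    Polynomial.natDegree_sum_le_of_forall_le _ _ fun i hi =>
      (Polynomial.natDegree_monomial_le _).trans (Finset.mem_range.1 hi).le
  set J : Finset ℕ := (Finset.range L).filter fun j => Q j ≠ 0 with hJ
  have hj₀J : j₀ ∈ J := by
    refine Finset.mem_filter.2 ⟨Finset.mem_range.2 hj₀, fun h => hp₀ ?_⟩
    rw [← hQc i₀ hi₀ j₀, h, Polynomial.coeff_zero]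
  set m := J.card with hm
  have hmL : m ≤ L := (Finset.card_filter_le _ _).trans (by simp)
  let e : Fin m ≃ J := J.equivFin.symm
  let A' : Matrix (Fin m) (Fin m) (Polynomial ℝ) := fun t s =>
    Polynomial.C (θ ^ ((t : ℕ) * (e s : ℕ))) * (Q (e s)).comp (Polynomial.X + Polynomial.C (t : ℝ))
  let v : Fin m → Polynomial ℝ := fun s => Polynomial.X ^ (K - (Q (e s)).natDegree)
  let A : Matrix (Fin m) (Fin m) (Polynomial ℝ) := Matrix.of fun t s => v s * A' t s
  have hdet : A.det = (∏ s, v s) * A'.det := Matrix.det_mul_row v A'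
  have hA'd : ∀ t s, (A' t s).natDegree ≤ (Q (e s)).natDegree := by
    intro t s
    refine (Polynomial.natDegree_C_mul_le _ _).trans ?_
    rw [Polynomial.natDegree_comp, Polynomial.natDegree_X_add_C, mul_one]
  have hA'c : ∀ t s, (A' t s).coeff (Q (e s)).natDegree =
      θ ^ ((t : ℕ) * (e s : ℕ)) * (Q (e s)).leadingCoeff := by
    intro t s
    have h1 : ((Q (e s)).comp (Polynomial.X + Polynomial.C (t : ℝ))).leadingCoeff
        = (Q (e s)).leadingCoeff := by
      rw [Polynomial.leadingCoeff_comp (by rw [Polynomial.natDegree_X_add_C]; exact one_ne_zero),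
        Polynomial.leadingCoeff_X_add_C, one_pow, mul_one]
    rw [← h1, Polynomial.coeff_C_mul, Polynomial.leadingCoeff, Polynomial.natDegree_comp,
      Polynomial.natDegree_X_add_C, mul_one]
  have hAd : ∀ t s, (A t s).natDegree ≤ K := by
    intro t s
    have h1 := hA'd t s
    have h2 := hQd (e s)
    have h3 : (v s).natDegree = K - (Q (e s)).natDegree := Polynomial.natDegree_X_pow _
    calc (A t s).natDegree ≤ (v s).natDegree + (A' t s).natDegree := Polynomial.natDegree_mul_le
      _ ≤ K := by omega
  have hAc : (A.map fun q => q.coeff K) = Matrix.of fun t s =>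
      (Q (e s)).leadingCoeff * (Matrix.vandermonde fun s => θ ^ (e s : ℕ)).transpose t s := by
    ext t s
    have h2 := hQd (e s)
    have h3 : K = (Q (e s)).natDegree + (K - (Q (e s)).natDegree) := by omega
    simp only [Matrix.map_apply, A, Matrix.of_apply, v, Matrix.transpose_apply,
      Matrix.vandermonde_apply]
    conv_lhs => rw [h3, Nat.add_sub_cancel_left, Polynomial.coeff_X_pow_mul, hA'c]
    rw [← pow_mul]
    ring_nf
  have hlead : A.det.coeff (Fintype.card (Fin m) * K) ≠ 0 := by
    rw [Polynomial.coeff_det_of_natDegree_le A hAd, hAc, Matrix.det_mul_row, Matrix.det_transpose]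
    refine mul_ne_zero (Finset.prod_ne_zero_iff.2 fun s _ => ?_) ?_
    · exact Polynomial.leadingCoeff_ne_zero.2 (Finset.mem_filter.1 (e s).2).2
    · rw [Matrix.det_vandermonde_ne_zero_iff]
      intro s s' h
      exact e.injective (Subtype.ext (pow_right_injective₀ hθ0 hθ1 h))
  have hA0 : A.det ≠ 0 := fun h => hlead (by rw [h, Polynomial.coeff_zero])
  have hroots : ∀ x ∈ S, A.det.IsRoot x := by
    intro x hx
    have hsing : (A'.map fun q => q.eval x).det = 0 := by
      rw [← Matrix.exists_mulVec_eq_zero_iff]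
      refine ⟨fun s => g x ^ (e s : ℕ), fun h => ?_, ?_⟩
      · exact pow_ne_zero _ (hg x hx) (congrFun h (J.equivFin ⟨j₀, hj₀J⟩))
      · ext t
        have h1 := hvan x hx t (t.2.trans_le hmL)
        rw [Finset.sum_comm] at h1
        have h2 : ∀ j, (∑ i ∈ Finset.range K, p i j * ((x + t) ^ i * (θ ^ (t : ℕ) * g x) ^ j))
            = θ ^ ((t : ℕ) * j) * (Q j).eval (x + t) * g x ^ j := by
          intro j
          rw [hQe, Finset.mul_sum, Finset.sum_mul]
          refine Finset.sum_congr rfl fun i _ => ?_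
          rw [mul_pow, pow_mul]; ring
        simp only [h2] at h1
        have h3 : ∑ j ∈ J, θ ^ ((t : ℕ) * j) * (Q j).eval (x + t) * g x ^ j = 0 := by
          rw [← h1]
          refine Finset.sum_subset (Finset.filter_subset _ _) fun j hj hjJ => ?_
          have : Q j = 0 := by
            by_contra h
            exact hjJ (Finset.mem_filter.2 ⟨hj, h⟩)
          simp [this]
        rw [← Finset.sum_coe_sort, ← Equiv.sum_comp e] at h3
        have hent : ∀ s, (A' t s).eval x =
            θ ^ ((t : ℕ) * (e s : ℕ)) * (Q (e s)).eval (x + (t : ℕ)) := by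
          intro s
          simp [A', Polynomial.eval_comp]
        change ∑ s, (A' t s).eval x * g x ^ (e s : ℕ) = 0
        simp only [hent]
        exact h3
    have h4 : A'.det.eval x = (A'.map fun q => q.eval x).det := by
      have := RingHom.map_det (Polynomial.evalRingHom x) A'
      simpa using this
    rw [Polynomial.IsRoot.def, hdet, Polynomial.eval_mul, h4, hsing, mul_zero]
  have hcard : S.card ≤ A.det.natDegree := by
    refine Polynomial.card_le_degree_of_subset_roots (Z := S) fun x hx => ?_
    exact (Polynomial.mem_roots hA0).2 (hroots x hx)
  have := hcard.trans (Polynomial.natDegree_det_le A hAd)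
  rw [Fintype.card_fin] at this
  have h5 : m * K ≤ L * K := Nat.mul_le_mul_right _ hmL
  rw [mul_comm L K] at h5
  omega

theorem Int.eq_zero_of_sq_eq_nonsquare_mul_sq {d : ℕ} (hd : ¬IsSquare d) {x y : ℤ}
    (h : x ^ 2 = d * y ^ 2) : x = 0 ∧ y = 0 := by
  have hy : y = 0 := by
    by_contra hy
    obtain ⟨z, rfl⟩ := (Int.pow_dvd_pow_iff two_ne_zero).1
      (⟨d, by rw [h, mul_comm]⟩ : y ^ 2 ∣ x ^ 2)
    have h1 : (d : ℤ) = z ^ 2 := by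
      have : y ^ 2 * (z ^ 2 - d) = 0 := by linear_combination h
      rcases mul_eq_zero.1 this with h | h
      · exact absurd (pow_eq_zero_iff two_ne_zero |>.1 h) hy
      · linarith
    apply hd
    refine ⟨z.natAbs, ?_⟩
    zify
    rw [h1, ← sq, sq_abs]
  subst hy
  simpa using h

/-- The two square roots of `d`. -/
noncomputable def signedSqrt (d : ℕ) (s : Bool) : ℝ := if s then √d else -√d

theorem signedSqrt_mul_self (d : ℕ) (s : Bool) : signedSqrt d s * signedSqrt d s = d := by
  cases s <;> simp [signedSqrt]

/-- Integral linear combinations of `1, √a, √b, √a√b`, seen through their four conjugates. -/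
noncomputable def biquadInt (a b : ℕ) : Subring (Bool × Bool → ℝ) where
  carrier := {f | ∃ n : Fin 4 → ℤ, ∀ s, f s = n 0 + n 1 * signedSqrt a s.1 +
    n 2 * signedSqrt b s.2 + n 3 * (signedSqrt a s.1 * signedSqrt b s.2)}
  mul_mem' := by
    rintro f g ⟨m, hm⟩ ⟨n, hn⟩
    refine ⟨![m 0 * n 0 + a * (m 1 * n 1) + b * (m 2 * n 2) + a * b * (m 3 * n 3),
      m 0 * n 1 + m 1 * n 0 + b * (m 2 * n 3 + m 3 * n 2),
      m 0 * n 2 + m 2 * n 0 + a * (m 1 * n 3 + m 3 * n 1),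
      m 0 * n 3 + m 3 * n 0 + m 1 * n 2 + m 2 * n 1], fun s => ?_⟩
    have ha := signedSqrt_mul_self a s.1
    have hb := signedSqrt_mul_self b s.2
    simp only [Pi.mul_apply, hm, hn, Matrix.cons_val]
    push_cast
    rw [← ha, ← hb]
    ring
  one_mem' := ⟨![1, 0, 0, 0], fun s => by simp⟩
  add_mem' := by
    rintro f g ⟨m, hm⟩ ⟨n, hn⟩
    refine ⟨m + n, fun s => ?_⟩
    simp only [Pi.add_apply, hm, hn]
    push_cast
    ring
  zero_mem' := ⟨0, fun s => by simp⟩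
  neg_mem' := by
    rintro f ⟨m, hm⟩
    refine ⟨-m, fun s => ?_⟩
    simp only [Pi.neg_apply, hm]
    push_cast
    ring

theorem left_mem_biquadInt (a b : ℕ) (m n : ℤ) :
    (fun s => m + n * signedSqrt a s.1) ∈ biquadInt a b :=
  ⟨![m, n, 0, 0], fun s => by simp⟩

theorem right_mem_biquadInt (a b : ℕ) (m n : ℤ) :
    (fun s => m + n * signedSqrt b s.2) ∈ biquadInt a b :=
  ⟨![m, 0, n, 0], fun s => by simp⟩

theorem one_le_sqrt_of_nonsquare {d : ℕ} (hd : ¬IsSquare d) : (1 : ℝ) ≤ √d := by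
  rw [one_le_sqrt]
  have : d ≠ 0 := fun h => hd (h ▸ ⟨0, rfl⟩)
  exact_mod_cast Nat.one_le_iff_ne_zero.2 this

theorem exists_coeff_le_of_mem_biquadInt {a b : ℕ} (ha : ¬IsSquare a) (hb : ¬IsSquare b)
    {f : Bool × Bool → ℝ} (hf : f ∈ biquadInt a b) {C : ℝ} (hC : ∀ s, |f s| ≤ C) :
    ∃ n : Fin 4 → ℤ, (∀ s, f s = n 0 + n 1 * signedSqrt a s.1 +
      n 2 * signedSqrt b s.2 + n 3 * (signedSqrt a s.1 * signedSqrt b s.2)) ∧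
      ∀ i, |(n i : ℝ)| ≤ C := by
  obtain ⟨n, hn⟩ := hf
  refine ⟨n, hn, ?_⟩
  have hu := one_le_sqrt_of_nonsquare ha
  have hv := one_le_sqrt_of_nonsquare hb
  have key : ∀ (x y : ℝ), 1 ≤ y → |x * y| ≤ C → |x| ≤ C := by
    intro x y hy h
    rw [abs_mul, abs_of_pos (by linarith : 0 < y)] at h
    exact (le_mul_of_one_le_right (abs_nonneg x) hy).trans h
  have h1 := abs_le.1 (hC (true, true))
  have h2 := abs_le.1 (hC (true, false))
  have h3 := abs_le.1 (hC (false, true))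
  have h4 := abs_le.1 (hC (false, false))
  simp only [hn, signedSqrt, if_true, Bool.false_eq_true, if_false] at h1 h2 h3 h4
  have huv : 1 ≤ √a * √b := one_le_mul_of_one_le_of_one_le hu hv
  intro i
  fin_cases i
  · rw [abs_le]; constructor <;> simp <;> linarith
  · refine key _ _ hu ?_
    rw [abs_le]; constructor <;> simp <;> linarith
  · refine key _ _ hv ?_
    rw [abs_le]; constructor <;> simp <;> linarith
  · refine key _ _ huv ?_
    rw [abs_le]; constructor <;> simp <;> linarith

/-- Liouville's inequality in the biquadratic order. -/
theorem one_le_abs_mul_pow_of_mem_biquadInt {a b : ℕ} (ha : ¬IsSquare a) (hb : ¬IsSquare b)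
    (hab : ¬IsSquare (a * b)) {f : Bool × Bool → ℝ} (hf : f ∈ biquadInt a b) {C : ℝ}
    (hC : ∀ s, |f s| ≤ C) (hne : f (true, true) ≠ 0) : 1 ≤ |f (true, true)| * C ^ 3 := by
  obtain ⟨n, hn⟩ := hf
  set P : ℤ := n 0 ^ 2 + a * n 1 ^ 2 - b * n 2 ^ 2 - a * b * n 3 ^ 2 with hP
  set Q : ℤ := 2 * (n 0 * n 1 - b * (n 2 * n 3)) with hQ
  have hu := Real.mul_self_sqrt (Nat.cast_nonneg (α := ℝ) a)
  have hv := Real.mul_self_sqrt (Nat.cast_nonneg (α := ℝ) b)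
  have hprod : f (true, true) * (f (true, false) * f (false, true) * f (false, false)) =
      ((P ^ 2 - a * Q ^ 2 : ℤ) : ℝ) := by
    simp only [hn, signedSqrt, if_true, Bool.false_eq_true, if_false, hP, hQ]
    push_cast
    set u := √(a : ℝ)
    set v := √(b : ℝ)
    rw [← hu, ← hv]
    ring
  have hN : P ^ 2 - a * Q ^ 2 ≠ 0 := by
    intro h
    obtain ⟨hP0, hQ0⟩ := Int.eq_zero_of_sq_eq_nonsquare_mul_sq ha (sub_eq_zero.1 h)
    rw [hP] at hP0
    have hQ0 : n 0 * n 1 - b * (n 2 * n 3) = 0 := by omega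
    have hfac : (n 0 ^ 2 - a * n 1 ^ 2 - b * (n 2 ^ 2 - a * n 3 ^ 2)) *
        (n 0 ^ 2 - a * n 1 ^ 2 + b * (n 2 ^ 2 - a * n 3 ^ 2)) = 0 := by
      linear_combination (n 0 ^ 2 + a * n 1 ^ 2 + b * n 2 ^ 2 + a * b * n 3 ^ 2) * hP0 -
        4 * a * (n 0 * n 1 + b * (n 2 * n 3)) * hQ0
    have hall : n 0 = 0 ∧ n 1 = 0 ∧ n 2 = 0 ∧ n 3 = 0 := by
      rcases mul_eq_zero.1 hfac with h | h
      · have h02 : n 0 ^ 2 = b * n 2 ^ 2 := by linarith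
        have ha0 : (a : ℤ) ≠ 0 := fun h => ha (by rw [Nat.cast_eq_zero.1 h]; exact ⟨0, rfl⟩)
        have h13 : n 1 ^ 2 = b * n 3 ^ 2 := by
          apply mul_left_cancel₀ ha0
          linarith
        have := Int.eq_zero_of_sq_eq_nonsquare_mul_sq hb h02
        have := Int.eq_zero_of_sq_eq_nonsquare_mul_sq hb h13
        tauto
      · have h03 : n 0 ^ 2 = (a * b : ℕ) * n 3 ^ 2 := by push_cast; linarith
        have h12 : (a * n 1) ^ 2 = (a * b : ℕ) * n 2 ^ 2 := by
          push_cast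
          have : (a : ℤ) * n 1 ^ 2 = b * n 2 ^ 2 := by linarith
          linear_combination (a : ℤ) * this
        have h1 := Int.eq_zero_of_sq_eq_nonsquare_mul_sq hab h03
        have h2 := Int.eq_zero_of_sq_eq_nonsquare_mul_sq hab h12
        have ha0 : (a : ℤ) ≠ 0 := fun h => ha (by rw [Nat.cast_eq_zero.1 h]; exact ⟨0, rfl⟩)
        have h3 : n 1 = 0 := (mul_eq_zero.1 h2.1).resolve_left ha0
        tauto
    apply hne
    rw [hn, hall.1, hall.2.1, hall.2.2.1, hall.2.2.2]
    simp
  have h1 : (1 : ℝ) ≤ |((P ^ 2 - a * Q ^ 2 : ℤ) : ℝ)| := by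
    exact_mod_cast Int.one_le_abs hN
  rw [← hprod, abs_mul, abs_mul, abs_mul] at h1
  have hC0 : 0 ≤ C := (abs_nonneg _).trans (hC (true, true))
  refine h1.trans (mul_le_mul_of_nonneg_left ?_ (abs_nonneg _))
  calc |f (true, false)| * |f (false, true)| * |f (false, false)| ≤ C * C * C := by
        gcongr <;> exact hC _
    _ = C ^ 3 := by ring

/-- Siegel's lemma in the biquadratic order. -/
theorem exists_int_combination_eq_zero {a b : ℕ} (ha : ¬IsSquare a) (hb : ¬IsSquare b)
    {ι κ : Type*} [Fintype ι] [Fintype κ] [Nonempty ι] (f : ι → κ → Bool × Bool → ℝ)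
    (hf : ∀ i k, f i k ∈ biquadInt a b) {C : ℝ} (hC1 : 1 ≤ C) (hC : ∀ i k s, |f i k s| ≤ C)
    (hcard : 8 * Fintype.card ι ≤ Fintype.card κ) :
    ∃ p : κ → ℤ, p ≠ 0 ∧ (∀ k, |(p k : ℝ)| ≤ Fintype.card κ * C) ∧
      ∀ i s, ∑ k, p k * f i k s = 0 := by
  choose n hn hnC using fun i k => exists_coeff_le_of_mem_biquadInt ha hb (hf i k) (hC i k)
  let A : Matrix (ι × Fin 4) κ ℤ := fun r k => n r.1 k r.2
  have hι : 0 < Fintype.card ι := Fintype.card_pos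
  have hr : Fintype.card (ι × Fin 4) = Fintype.card ι * 4 := by simp
  let _ := Matrix.seminormedAddCommGroup (m := ι × Fin 4) (n := κ) (α := ℤ)
  obtain ⟨p, hp0, hpA, hpn⟩ := Int.Matrix.exists_ne_zero_int_vec_norm_le A (by omega) (by omega)
  have hA : ‖A‖ ≤ C := by
    rw [Matrix.norm_le_iff (by linarith)]
    intro r k
    rw [Int.norm_eq_abs]
    exact_mod_cast hnC r.1 k r.2
  have hκ : (8 : ℝ) * Fintype.card ι ≤ Fintype.card κ := by exact_mod_cast hcard
  have hι' : (1 : ℝ) ≤ Fintype.card ι := by exact_mod_cast hι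
  have hpn' : ‖p‖ ≤ Fintype.card κ * C := by
    refine hpn.trans ?_
    have h1 : (1 : ℝ) ≤ Fintype.card κ * max 1 ‖A‖ :=
      one_le_mul_of_one_le_of_one_le (by linarith) (le_max_left _ _)
    refine (rpow_le_rpow_of_exponent_le h1 (?_ : _ ≤ (1 : ℝ))).trans ?_
    · rw [hr, div_le_one (by push_cast; linarith)]
      push_cast; linarith
    · rw [rpow_one]
      gcongr
      exact max_le hC1 hA
  refine ⟨p, hp0, fun k => ?_, fun i s => ?_⟩
  · rw [← Int.norm_eq_abs]
    exact (norm_le_pi_norm p k).trans hpn'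
  · have hz : ∀ c, ∑ k, (p k : ℝ) * n i k c = 0 := by
      intro c
      have := congrFun hpA (i, c)
      simp only [Matrix.mulVec, dotProduct, A, Pi.zero_apply] at this
      rw [← Int.cast_zero, ← this]
      push_cast
      exact Finset.sum_congr rfl fun k _ => mul_comm _ _
    have hexp : ∀ k, (p k : ℝ) * f i k s = p k * n i k 0 + p k * n i k 1 * signedSqrt a s.1 +
        p k * n i k 2 * signedSqrt b s.2 +
        p k * n i k 3 * (signedSqrt a s.1 * signedSqrt b s.2) := by
      intro k; rw [hn]; ring
    simp only [hexp, Finset.sum_add_distrib, ← Finset.sum_mul, hz]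
    ring

theorem zpow_mem_of_mul_eq_one {a b : ℕ} {f g : Bool × Bool → ℝ} (hf : f ∈ biquadInt a b)
    (hg : g ∈ biquadInt a b) (h : ∀ s, f s * g s = 1) (k : ℤ) :
    (fun s => f s ^ k) ∈ biquadInt a b := by
  rcases Int.eq_nat_or_neg k with ⟨n, rfl | rfl⟩
  · have : (fun s => f s ^ (n : ℤ)) = f ^ n := by
      ext s
      rw [zpow_natCast, Pi.pow_apply]
    rw [this]
    exact pow_mem hf n
  · have : (fun s => f s ^ (-(n : ℤ))) = g ^ n := by
      ext s
      rw [zpow_neg, zpow_natCast, ← inv_pow, inv_eq_of_mul_eq_one_right (h s), Pi.pow_apply]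
    rw [this]
    exact pow_mem hg n

theorem abs_zpow_le_of_mul_eq_one {x y U : ℝ} (hxy : x * y = 1) (hx : |x| ≤ exp U)
    (hy : |y| ≤ exp U) {k : ℤ} {Γ : ℝ} (hU : 0 ≤ U) (hk : |(k : ℝ)| ≤ Γ) :
    |x ^ k| ≤ exp (Γ * U) := by
  have key : ∀ z : ℝ, |z| ≤ exp U → ∀ n : ℕ, (n : ℝ) ≤ Γ → |z| ^ n ≤ exp (Γ * U) := by
    intro z hz n hn
    calc |z| ^ n ≤ exp U ^ n := by gcongr
      _ = exp (n * U) := (exp_nat_mul U n).symm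
      _ ≤ exp (Γ * U) := by gcongr
  rcases Int.eq_nat_or_neg k with ⟨n, rfl | rfl⟩
  · rw [zpow_natCast, abs_pow]
    exact key x hx n (by simpa using hk)
  · rw [zpow_neg, zpow_natCast, ← inv_pow, inv_eq_of_mul_eq_one_right hxy, abs_pow]
    exact key y hy n (by simpa using hk)

/-- Integral multiples of the powers of `ε ^ γ₁ η ^ γ₂ (G₁ / G₂) ^ γ₃`, by a common denominator. -/
theorem exists_integral_powers {a b : ℕ} {e e' h h' G₁ G₂ : Bool × Bool → ℝ}
    (he : e ∈ biquadInt a b) (he' : e' ∈ biquadInt a b) (hh : h ∈ biquadInt a b)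
    (hh' : h' ∈ biquadInt a b) (hG₁ : G₁ ∈ biquadInt a b) (hG₂ : G₂ ∈ biquadInt a b)
    (hee : ∀ s, e s * e' s = 1) (hhh : ∀ s, h s * h' s = 1) {U : ℝ} (hU : 0 ≤ U)
    (heU : ∀ s, |e s| ≤ exp U) (heU' : ∀ s, |e' s| ≤ exp U) (hhU : ∀ s, |h s| ≤ exp U)
    (hhU' : ∀ s, |h' s| ≤ exp U) (hGU₁ : ∀ s, |G₁ s| ≤ exp U) (hGU₂ : ∀ s, |G₂ s| ≤ exp U)
    {l₁ l₂ g₁ g₂ : ℝ} (hl₁ : e (true, true) = exp l₁) (hl₂ : h (true, true) = exp l₂)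
    (hg₁ : G₁ (true, true) = exp g₁) (hg₂ : G₂ (true, true) = exp g₂) {Γ : ℝ} (L : ℕ)
    {c₁ c₂ c₃ : ℤ} (hc₁ : |(c₁ : ℝ)| ≤ Γ) (hc₂ : |(c₂ : ℝ)| ≤ Γ) (hc₃ : |(c₃ : ℝ)| ≤ Γ) :
    ∃ f : ℕ → Bool × Bool → ℝ, ∃ D : ℝ, 0 < D ∧ ∀ j ≤ L, f j ∈ biquadInt a b ∧
      (∀ s, |f j s| ≤ exp (3 * L * Γ * U)) ∧
      f j (true, true) = exp (c₁ * l₁ + c₂ * l₂ + c₃ * (g₁ - g₂)) ^ j * D := by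
  have hΓ : 0 ≤ Γ := (abs_nonneg _).trans hc₁
  obtain ⟨F₁, F₂, c, hF₁, hF₂, hF₁U, hF₂U, d₁, d₂, hd₁, hd₂, hc, hcd⟩ :
      ∃ (F₁ F₂ : Bool × Bool → ℝ) (c : ℕ), F₁ ∈ biquadInt a b ∧ F₂ ∈ biquadInt a b ∧
        (∀ s, |F₁ s| ≤ exp U) ∧ (∀ s, |F₂ s| ≤ exp U) ∧ ∃ d₁ d₂ : ℝ,
        F₁ (true, true) = exp d₁ ∧ F₂ (true, true) = exp d₂ ∧ (c : ℝ) ≤ Γ ∧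
        c * (d₁ - d₂) = c₃ * (g₁ - g₂) := by
    rcases Int.eq_nat_or_neg c₃ with ⟨n, rfl | rfl⟩
    · exact ⟨G₁, G₂, n, hG₁, hG₂, hGU₁, hGU₂, g₁, g₂, hg₁, hg₂, by simpa using hc₃, by simp⟩
    · exact ⟨G₂, G₁, n, hG₂, hG₁, hGU₂, hGU₁, g₂, g₁, hg₂, hg₁, by simpa using hc₃,
        by push_cast; ring⟩
  refine ⟨fun j s => (e s ^ c₁ * h s ^ c₂) ^ j * (F₁ s ^ c) ^ j * (F₂ s ^ c) ^ (L - j),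
    exp (c * L * d₂), exp_pos _, fun j hj => ⟨?_, fun s => ?_, ?_⟩⟩
  · exact mul_mem (mul_mem (pow_mem (mul_mem (zpow_mem_of_mul_eq_one he he' hee _)
      (zpow_mem_of_mul_eq_one hh hh' hhh _)) j) (pow_mem (pow_mem hF₁ c) j))
      (pow_mem (pow_mem hF₂ c) (L - j))
  · have h1 := abs_zpow_le_of_mul_eq_one (hee s) (heU s) (heU' s) hU hc₁
    have h2 := abs_zpow_le_of_mul_eq_one (hhh s) (hhU s) (hhU' s) hU hc₂
    have hF : ∀ z : ℝ, |z| ≤ exp U → |z| ^ c ≤ exp (Γ * U) := by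
      intro z hz
      calc |z| ^ c ≤ exp U ^ c := by gcongr
        _ = exp (c * U) := (exp_nat_mul U c).symm
        _ ≤ exp (Γ * U) := by gcongr
    have h3 := hF _ (hF₁U s)
    have h4 := hF _ (hF₂U s)
    have hjL : (j : ℝ) ≤ L := by exact_mod_cast hj
    simp only [abs_mul, abs_pow]
    calc (|e s ^ c₁| * |h s ^ c₂|) ^ j * (|F₁ s| ^ c) ^ j * (|F₂ s| ^ c) ^ (L - j)
        ≤ (exp (Γ * U) * exp (Γ * U)) ^ j * exp (Γ * U) ^ j * exp (Γ * U) ^ (L - j) := by gcongr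
      _ = exp ((L + 2 * j) * (Γ * U)) := by
          rw [mul_assoc, ← pow_add, Nat.add_sub_cancel' hj, ← exp_add, ← exp_nat_mul, ← exp_nat_mul,
            ← exp_add]
          ring_nf
      _ ≤ exp (3 * L * Γ * U) := by
          rw [exp_le_exp]
          have : 0 ≤ Γ * U := by positivity
          nlinarith
  · have hz : ∀ (y : ℝ) (k : ℤ), exp y ^ k = exp (k * y) := fun y k => by
      rw [← rpow_intCast, ← exp_mul, mul_comm]
    simp only [hl₁, hl₂, hd₁, hd₂, hz, ← exp_nat_mul, ← exp_add]
    rw [Nat.cast_sub hj, ← hcd]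
    ring_nf

/-- The auxiliary function method: a family of points `x`, each carrying an algebraic number close
to `exp (φ x)`, contradicts the zero estimate when it is too large. -/
theorem false_of_many_points {a b : ℕ} (ha : ¬IsSquare a) (hb : ¬IsSquare b)
    (hab : ¬IsSquare (a * b)) {E : Set (ℤ × ℤ)} {K L n : ℕ} {φ Λ M T V δ : ℝ} (hφ : φ ≠ 0)
    (hM1 : 1 ≤ M) (hEM : ∀ z ∈ E, |(z.1 : ℝ)| ≤ M)
    (hpow : ∀ z ∈ E, ∃ f : ℕ → Bool × Bool → ℝ, ∃ D : ℝ, 0 < D ∧ ∀ j ≤ L, f j ∈ biquadInt a b ∧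
      (∀ s, |f j s| ≤ exp V) ∧ f j (true, true) = exp (z.1 * φ + z.2 * Λ) ^ j * D)
    (hT : L * |φ| * M ≤ T) (hδ1 : δ ≤ 1) (hΛ : ∀ z ∈ E, L * |z.2 * Λ| ≤ δ)
    {S : Finset ℤ} {Y : ℤ → ℤ} (hS : ∀ x ∈ S, ∀ t : ℕ, t < L → (x + t, Y x) ∈ E)
    (hn0 : 0 < n) (hn : 8 * n ≤ K * L) (hKLS : K * L < S.card) (hKLV : (K : ℝ) * L ≤ exp V)
    (hMV : M ^ K ≤ exp V) (hTV : T ≤ V) (hVn : 27 * V ≤ n) (hKT : 2 * (K + T) * exp 3 ≤ n)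
    (hδ : (n * (2 * M) ^ n + 1) * (2 * δ) * exp (27 * V) ≤ 1 / 4) : False := by
  classical
  have hKpos : 0 < K * L := by omega
  have hL : 0 < L := Nat.pos_of_mul_pos_left hKpos
  have hSne : S.Nonempty := Finset.card_pos.1 (by omega)
  have hT0 : 0 ≤ T := (by positivity : 0 ≤ L * |φ| * M).trans hT
  have hδ0 : 0 ≤ δ := by
    obtain ⟨x, hx⟩ := hSne
    exact (by positivity : 0 ≤ L * |((x + (0 : ℕ), Y x) : ℤ × ℤ).2 * Λ|).trans (hΛ _ (hS x hx 0 hL))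
  obtain ⟨S₀, hS₀S, hS₀⟩ := Finset.exists_subset_card_eq (show n ≤ S.card by nlinarith)
  have hSE : ∀ x ∈ S, (x, Y x) ∈ E := fun x hx => by simpa using hS x hx 0 hL
  choose! f D hD hfD using hpow
  have hMx : ∀ z ∈ E, ∀ i < K, |(z.1 : ℝ)| ^ i ≤ M ^ K := fun z hz i hi =>
    (pow_le_pow_left₀ (abs_nonneg _) (hEM z hz) i).trans (pow_le_pow_right₀ hM1 hi.le)
  have hterm_mem : ∀ z ∈ E, ∀ i j, j < L → (fun s => (z.1 : ℝ) ^ i * f z j s) ∈ biquadInt a b := by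
    intro z hz i j hj
    have h1 : (fun s : Bool × Bool => (z.1 : ℝ) ^ i * f z j s) =
        ((z.1 : Bool × Bool → ℝ)) ^ i * f z j := by
      ext s; simp
    rw [h1]
    exact mul_mem (pow_mem (intCast_mem _ _) _) (hfD z hz j hj.le).1
  have hterm_le : ∀ z ∈ E, ∀ i < K, ∀ j < L, ∀ s, |(z.1 : ℝ) ^ i * f z j s| ≤ exp (2 * V) := by
    intro z hz i hi j hj s
    rw [abs_mul, abs_pow, two_mul, exp_add]
    exact mul_le_mul ((hMx z hz i hi).trans hMV) ((hfD z hz j hj.le).2.1 s) (abs_nonneg _)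
      (exp_pos _).le
  have hV0 : 0 ≤ V := hT0.trans hTV
  have : Nonempty S₀ := by
    rw [← Fintype.card_pos_iff, Fintype.card_coe]; omega
  obtain ⟨p, hp0, hpB, hpz⟩ := exists_int_combination_eq_zero ha hb
    (fun (x : S₀) (k : Fin K × Fin L) s => ((x : ℤ) : ℝ) ^ (k.1 : ℕ) * f (x, Y x) k.2 s)
    (fun x k => hterm_mem (x, Y x) (hSE x (hS₀S x.2)) k.1 k.2 k.2.2) (C := exp (2 * V))
    (one_le_exp (by positivity))
    (fun x k s => hterm_le (x, Y x) (hSE x (hS₀S x.2)) k.1 k.1.2 k.2 k.2.2 s)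
    (by simpa [hS₀] using hn)
  obtain ⟨P, hP⟩ : ∃ P : ℕ → ℕ → ℤ, ∀ k : Fin K × Fin L, p k = P k.1 k.2 :=
    ⟨fun i j => if h : i < K ∧ j < L then p (⟨i, h.1⟩, ⟨j, h.2⟩) else 0, fun k => by simp⟩
  have hsum : ∀ g : ℕ → ℕ → ℝ, ∑ k : Fin K × Fin L, (p k : ℝ) * g k.1 k.2 =
      ∑ i ∈ Finset.range K, ∑ j ∈ Finset.range L, (P i j : ℝ) * g i j := by
    intro g
    simp only [Fintype.sum_prod_type, Finset.sum_range, hP]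
  have hPB : ∀ i < K, ∀ j < L, |(P i j : ℝ)| ≤ exp (3 * V) := by
    intro i hi j hj
    have := hpB (⟨i, hi⟩, ⟨j, hj⟩)
    rw [hP] at this
    refine this.trans ?_
    simp only [Fintype.card_prod, Fintype.card_fin]
    push_cast
    calc (K : ℝ) * L * exp (2 * V) ≤ exp V * exp (2 * V) := by gcongr
      _ = exp (3 * V) := by rw [← exp_add]; ring_nf
  set W : ℤ × ℤ → ℝ := fun z => ∑ i ∈ Finset.range K, ∑ j ∈ Finset.range L,
    (P i j : ℝ) * ((z.1 : ℝ) ^ i * exp (z.1 * φ + z.2 * Λ) ^ j) with hW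
  have hWD : ∀ z ∈ E, ∑ i ∈ Finset.range K, ∑ j ∈ Finset.range L,
      (P i j : ℝ) * ((z.1 : ℝ) ^ i * f z j (true, true)) = W z * D z := by
    intro z hz
    simp only [hW, Finset.sum_mul]
    refine Finset.sum_congr rfl fun i _ => Finset.sum_congr rfl fun j hj => ?_
    rw [(hfD z hz j (Finset.mem_range.1 hj).le).2.2]
    ring
  have hW0 : ∀ x ∈ S₀, W (x, Y x) = 0 := by
    intro x hx
    have h1 := hpz ⟨x, hx⟩ (true, true)
    rw [hsum (fun i j => (x : ℝ) ^ i * f (x, Y x) j (true, true)), hWD _ (hSE x (hS₀S hx))] at h1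
    exact (mul_eq_zero.1 h1).resolve_right (hD _ (hSE x (hS₀S hx))).ne'
  set F : ℤ → ℝ := fun x => ∑ i ∈ Finset.range K, ∑ j ∈ Finset.range L,
    (P i j : ℝ) * ((x : ℝ) ^ i * exp (j * φ * x)) with hF
  have hsumle : ∀ (g : ℕ → ℕ → ℝ) (c : ℝ), (∀ i < K, ∀ j < L, |g i j| ≤ c) →
      |∑ i ∈ Finset.range K, ∑ j ∈ Finset.range L, g i j| ≤ K * L * c := by
    intro g c hg
    refine (Finset.abs_sum_le_sum_abs _ _).trans ?_
    rw [mul_assoc, ← nsmul_eq_mul, ← nsmul_eq_mul]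
    refine (Finset.sum_le_card_nsmul _ _ (L • c) fun i hi => ?_).trans_eq (by simp)
    refine (Finset.abs_sum_le_sum_abs _ _).trans ?_
    refine (Finset.sum_le_card_nsmul _ _ c fun j hj => ?_).trans_eq (by simp)
    exact hg i (Finset.mem_range.1 hi) j (Finset.mem_range.1 hj)
  have hFW : ∀ z ∈ E, |F z.1 - W z| ≤ exp (6 * V) * (2 * δ) := by
    intro z hz
    have h1 : F z.1 - W z = ∑ i ∈ Finset.range K, ∑ j ∈ Finset.range L,
        (P i j : ℝ) * ((z.1 : ℝ) ^ i * (exp (j * φ * z.1) * (1 - exp (j * (z.2 * Λ))))) := by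
      simp only [hF, hW, ← Finset.sum_sub_distrib]
      refine Finset.sum_congr rfl fun i _ => Finset.sum_congr rfl fun j _ => ?_
      rw [← exp_nat_mul, mul_sub, mul_one, ← exp_add]
      ring_nf
    rw [h1]
    refine (hsumle _ (exp (3 * V) * (exp V * (exp V * (2 * δ)))) fun i hi j hj => ?_).trans ?_
    · have hjL : (j : ℝ) ≤ L := by exact_mod_cast hj.le
      have h2 : |(j : ℝ) * (z.2 * Λ)| ≤ δ := by
        rw [abs_mul, Nat.abs_cast]
        exact (mul_le_mul_of_nonneg_right hjL (abs_nonneg _)).trans (hΛ z hz)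
      have h3 : |1 - exp (j * (z.2 * Λ))| ≤ 2 * δ := by
        rw [abs_sub_comm]
        exact (abs_exp_sub_one_le (h2.trans hδ1)).trans (by linarith)
      have h4 : exp (j * φ * z.1) ≤ exp V := by
        rw [exp_le_exp]
        refine (le_abs_self _).trans (le_trans ?_ (hT.trans hTV))
        rw [abs_mul, abs_mul, Nat.abs_cast]
        gcongr
        exact hEM z hz
      rw [abs_mul, abs_mul, abs_mul, abs_pow, abs_exp]
      gcongr
      · exact hPB i hi j hj
      · exact (hMx z hz i hi).trans hMV
    · calc (K : ℝ) * L * (exp (3 * V) * (exp V * (exp V * (2 * δ))))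
          ≤ exp V * (exp (3 * V) * (exp V * (exp V * (2 * δ)))) := by gcongr
        _ = exp (6 * V) * (2 * δ) := by
            rw [show 6 * V = V + (3 * V + (V + V)) by ring, exp_add, exp_add, exp_add]; ring
  have hFle : ∀ x : ℤ, |(x : ℝ)| ≤ M →
      |F x| ≤ exp (6 * V) * exp (-(2 * n)) + n * (exp (6 * V) * (2 * δ)) * (2 * M) ^ n := by
    intro x hx
    have h1 := abs_expPoly_le (fun i j => (P i j : ℝ)) hM1 hPB hT S₀
      (fun x hx => hEM _ (hSE x (hS₀S hx))) (by rw [hS₀]; exact hKT)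
      (δ := exp (6 * V) * (2 * δ)) (fun x hx => by
        have := hFW _ (hSE x (hS₀S hx))
        rw [hW0 x hx, sub_zero] at this
        exact this) x hx
    rw [hS₀] at h1
    refine h1.trans ?_
    gcongr
    calc (K : ℝ) * L * exp (3 * V) * M ^ K * exp T
        ≤ exp V * exp (3 * V) * exp V * exp V := by gcongr
      _ = exp (6 * V) := by
          rw [← exp_add, ← exp_add, ← exp_add]; ring_nf
  have hWzero : ∀ z ∈ E, W z = 0 := by
    intro z hz
    by_contra hne
    set g : Bool × Bool → ℝ := ∑ i ∈ Finset.range K, ∑ j ∈ Finset.range L,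
      (fun s => (P i j : ℝ) * ((z.1 : ℝ) ^ i * f z j s)) with hg
    have hgs : ∀ s, g s = ∑ i ∈ Finset.range K, ∑ j ∈ Finset.range L,
        (P i j : ℝ) * ((z.1 : ℝ) ^ i * f z j s) := by
      intro s; simp [hg, Finset.sum_apply]
    have hgmem : g ∈ biquadInt a b := by
      refine sum_mem fun i _ => sum_mem fun j hj => ?_
      have h1 : (fun s => (P i j : ℝ) * ((z.1 : ℝ) ^ i * f z j s)) =
          ((P i j : Bool × Bool → ℝ)) * (fun s => (z.1 : ℝ) ^ i * f z j s) := by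
        ext s; simp
      rw [h1]
      exact mul_mem (intCast_mem _ _) (hterm_mem z hz i j (Finset.mem_range.1 hj))
    have hgle : ∀ s, |g s| ≤ exp (6 * V) := by
      intro s
      rw [hgs]
      refine (hsumle _ (exp (3 * V) * exp (2 * V)) fun i hi j hj => ?_).trans ?_
      · rw [abs_mul]
        exact mul_le_mul (hPB i hi j hj) (hterm_le z hz i hi j hj s) (abs_nonneg _) (exp_pos _).le
      · calc (K : ℝ) * L * (exp (3 * V) * exp (2 * V)) ≤ exp V * (exp (3 * V) * exp (2 * V)) := by
              gcongr
          _ = exp (6 * V) := by rw [← exp_add, ← exp_add]; ring_nf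
    have hgt : g (true, true) = W z * D z := by rw [hgs, hWD z hz]
    have hDz := hD z hz
    have hliou := one_le_abs_mul_pow_of_mem_biquadInt ha hb hab hgmem hgle
      (by rw [hgt]; exact mul_ne_zero hne hDz.ne')
    have hDle : D z ≤ exp V := by
      have h1 := hfD z hz 0 (Nat.zero_le _)
      have h2 := h1.2.1 (true, true)
      rw [h1.2.2, pow_zero, one_mul, abs_of_pos hDz] at h2
      exact h2
    have hWle : |W z| ≤ exp (6 * V) * exp (-(2 * n)) +
        exp (6 * V) * ((n * (2 * M) ^ n + 1) * (2 * δ)) := by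
      have h1 := hFle z.1 (hEM z hz)
      have h2 := hFW z hz
      have h3 : |W z| ≤ |F z.1| + |F z.1 - W z| := by
        have := abs_sub (F z.1) (F z.1 - W z)
        rwa [sub_sub_cancel] at this
      linarith
    rw [hgt, abs_mul, abs_of_pos hDz] at hliou
    have h6 : exp (6 * V) ^ 3 = exp (18 * V) := by rw [← exp_nat_mul]; push_cast; ring_nf
    have hE1 : exp (6 * V) * exp (-(2 * n)) * exp V * exp (18 * V) ≤ 1 / 2 := by
      rw [← exp_add, ← exp_add, ← exp_add]
      have h1 : (1 : ℝ) ≤ n := by exact_mod_cast hn0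
      calc exp (6 * V + -(2 * n) + V + 18 * V) ≤ exp (-1) := by
            rw [exp_le_exp]; nlinarith
        _ ≤ 1 / 2 := by
            rw [exp_neg, inv_le_comm₀ (exp_pos _) (by norm_num)]
            have := add_one_le_exp (1 : ℝ)
            norm_num at this ⊢; linarith
    have hE2 : exp (6 * V) * ((n * (2 * M) ^ n + 1) * (2 * δ)) * exp V * exp (18 * V) ≤ 1 / 4 := by
      refine le_trans ?_ hδ
      calc exp (6 * V) * ((n * (2 * M) ^ n + 1) * (2 * δ)) * exp V * exp (18 * V)
          = (n * (2 * M) ^ n + 1) * (2 * δ) * exp (25 * V) := by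
            rw [show 25 * V = 6 * V + (V + 18 * V) by ring, exp_add, exp_add]; ring
        _ ≤ _ := by gcongr; norm_num
    have : |W z| * D z * exp (6 * V) ^ 3 ≤ 1 / 2 + 1 / 4 := by
      rw [h6]
      calc |W z| * D z * exp (18 * V)
          ≤ (exp (6 * V) * exp (-(2 * n)) + exp (6 * V) * ((n * (2 * M) ^ n + 1) * (2 * δ))) *
            exp V * exp (18 * V) := by gcongr
        _ = exp (6 * V) * exp (-(2 * n)) * exp V * exp (18 * V) +
            exp (6 * V) * ((n * (2 * M) ^ n + 1) * (2 * δ)) * exp V * exp (18 * V) := by ring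
        _ ≤ _ := add_le_add hE1 hE2
    linarith
  have hPzero := eq_zero_of_vanishing (K := K) (L := L) (fun i j => (P i j : ℝ)) (exp_pos φ)
    (by rwa [Ne, exp_eq_one_iff]) (S.image fun x : ℤ => (x : ℝ))
    (fun x => exp (x * φ + Y ⌊x⌋ * Λ)) (fun _ _ => (exp_pos _).ne')
    (by rwa [Finset.card_image_of_injective _ Int.cast_injective])
    (by
      simp only [Finset.mem_image]
      rintro _ ⟨x, hx, rfl⟩ t ht
      have h1 := hWzero _ (hS x hx t ht)
      rw [← h1]
      refine Finset.sum_congr rfl fun i _ => Finset.sum_congr rfl fun j _ => ?_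
      rw [← exp_nat_mul, ← exp_add, Int.floor_intCast]
      push_cast
      ring_nf)
  refine hp0 (funext fun k => ?_)
  rw [hP]
  exact_mod_cast hPzero k.1 k.1.2 k.2 k.2.2

/-- Many lattice points in a thin parallelogram, by the pigeonhole principle. -/
theorem exists_lattice_points {r : ℕ} (hr : 1000 ≤ r) {k l : ℤ} (hk : (r : ℝ) ^ 140 ≤ 8 * k)
    (hk' : (k : ℝ) ≤ 16 * (r : ℝ) ^ 140) (hl : 0 < l) (hl' : (l : ℝ) ≤ 16 * (r : ℝ) ^ 140) :
    ∃ (q ρ : ℤ) (S : Finset ℤ) (Y : ℤ → ℤ), 0 < q ∧ (q : ℝ) ≤ (r : ℝ) ^ 70 ∧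
      |(q * l - k * ρ : ℝ)| * (r : ℝ) ^ 70 ≤ k ∧ 8 * r ^ 197 < S.card ∧
      ∀ x ∈ S, ∀ t : ℕ, t < r → |((x + t : ℤ) : ℝ)| ≤ 2 * (r : ℝ) ^ 204 ∧
        |(((x + t) * q + Y x * k : ℤ) : ℝ)| ≤ (r : ℝ) ^ 135 ∧
        |(((x + t) * ρ + Y x * l : ℤ) : ℝ)| ≤ (r : ℝ) ^ 135 ∧ |(Y x : ℝ)| ≤ (r : ℝ) ^ 135 := by
  set R : ℝ := (r : ℝ) with hR
  have hR1 : (1000 : ℝ) ≤ R := by rw [hR]; exact_mod_cast hr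
  have hRp : ∀ m, 0 < R ^ m := fun m => by positivity
  have hkpos : (0 : ℝ) < k := by have := hRp 140; linarith
  have hk0 : 0 < k := by exact_mod_cast hkpos
  have hlpos : (0 : ℝ) < l := by exact_mod_cast hl
  obtain ⟨ρ, q, hq0, hq, hqρ⟩ := Real.exists_int_int_abs_mul_sub_le ((l : ℝ) / k)
    (n := r ^ 70) (by positivity)
  have hqR : (q : ℝ) ≤ R ^ 70 := by
    have : (q : ℝ) ≤ ((r ^ 70 : ℕ) : ℝ) := by exact_mod_cast hq
    simpa using this
  have hq0R : (0 : ℝ) < q := by exact_mod_cast hq0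
  have hdio : |(q * l - k * ρ : ℝ)| * R ^ 70 ≤ k := by
    have h1 : (q * l - k * ρ : ℝ) = k * (q * (l / k) - ρ) := by field_simp
    have h2 : |(q : ℝ) * (l / k) - ρ| * R ^ 70 ≤ 1 := by
      have h3 : |(q : ℝ) * (l / k) - ρ| * (R ^ 70 + 1) ≤ 1 := by
        have := mul_le_mul_of_nonneg_right hqρ (by positivity : 0 ≤ R ^ 70 + 1)
        push_cast at this
        rwa [one_div, inv_mul_cancel₀ (by positivity)] at this
      nlinarith [abs_nonneg ((q : ℝ) * (l / k) - ρ)]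
    rw [h1, abs_mul, abs_of_pos hkpos, mul_assoc]
    exact mul_le_of_le_one_right hkpos.le h2
  set w : ℤ := (r : ℤ) ^ 134 with hw
  have hw0 : 0 < w := by positivity
  have hwR : (w : ℝ) = R ^ 134 := by simp [hw, hR]
  let box : ℤ → ℤ := fun x => (x * q % k) / w
  have hkZ : k ≤ 16 * (r : ℤ) ^ 140 := by
    have : (k : ℝ) ≤ ((16 * (r : ℤ) ^ 140 : ℤ) : ℝ) := by push_cast; exact hk'
    exact_mod_cast this
  have hmaps : ∀ x ∈ Finset.Ico (0 : ℤ) ((r : ℤ) ^ 204),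
      box x ∈ Finset.Ico (0 : ℤ) (17 * (r : ℤ) ^ 6) := by
    intro x _
    have h1 := Int.emod_nonneg (x * q) hk0.ne'
    have h2 := Int.emod_lt_of_pos (x * q) hk0
    rw [Finset.mem_Ico]
    refine ⟨Int.ediv_nonneg h1 hw0.le, Int.ediv_lt_of_lt_mul hw0 ?_⟩
    have h3 : 17 * (r : ℤ) ^ 6 * w = 17 * (r : ℤ) ^ 140 := by rw [hw]; ring
    have h4 : 0 < (r : ℤ) ^ 140 := by positivity
    linarith
  obtain ⟨y, -, hy⟩ := Finset.exists_lt_card_fiber_of_mul_lt_card_of_maps_to hmaps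
    (n := 8 * r ^ 197) (by
      rw [Int.card_Ico, Int.card_Ico]
      have h1 : (17 * (r : ℤ) ^ 6 - 0).toNat = 17 * r ^ 6 := by
        rw [sub_zero]; exact_mod_cast Int.toNat_natCast (17 * r ^ 6)
      have h2 : ((r : ℤ) ^ 204 - 0).toNat = r ^ 204 := by
        rw [sub_zero]; exact_mod_cast Int.toNat_natCast (r ^ 204)
      rw [h1, h2]
      have h3 : 0 < r ^ 203 := by positivity
      calc 17 * r ^ 6 * (8 * r ^ 197) = 136 * r ^ 203 := by ring
        _ < r * r ^ 203 := by apply Nat.mul_lt_mul_of_pos_right (by omega) h3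
        _ = r ^ 204 := by ring)
  set S₀ := (Finset.Ico (0 : ℤ) ((r : ℤ) ^ 204)).filter (fun x => box x = y) with hS₀
  obtain ⟨x₀, hx₀⟩ : S₀.Nonempty := Finset.card_pos.1 (by omega)
  refine ⟨q, ρ, S₀.image fun x => x - x₀, fun x => x₀ * q / k - (x + x₀) * q / k, hq0, hqR, hdio,
    ?_, ?_⟩
  · rwa [Finset.card_image_of_injective _ (sub_left_injective)]
  intro x' hx' t ht
  obtain ⟨x, hx, rfl⟩ := Finset.mem_image.1 hx'
  simp only [sub_add_cancel]
  obtain ⟨hx1, hx2⟩ := Finset.mem_filter.1 hx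
  obtain ⟨hx₀1, hx₀2⟩ := Finset.mem_filter.1 hx₀
  rw [Finset.mem_Ico] at hx1 hx₀1
  set Yv : ℤ := x₀ * q / k - x * q / k with hYv
  have htR : (t : ℝ) ≤ R := by rw [hR]; exact_mod_cast ht.le
  have hxx : |((x - x₀ : ℤ) : ℝ)| ≤ R ^ 204 := by
    have : |x - x₀| ≤ (r : ℤ) ^ 204 := by rw [abs_le]; constructor <;> linarith
    rw [hR]; exact_mod_cast this
  have hbox : |(((x - x₀) * q + Yv * k : ℤ) : ℝ)| ≤ R ^ 134 := by
    have h1 : (x - x₀) * q + Yv * k = x * q % k - x₀ * q % k := by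
      have e1 := Int.emod_add_mul_ediv (x * q) k
      have e2 := Int.emod_add_mul_ediv (x₀ * q) k
      rw [hYv]; linear_combination e2 - e1
    have h2 : |x * q % k - x₀ * q % k| ≤ w := by
      have e1 := Int.emod_add_mul_ediv (x * q % k) w
      have e2 := Int.emod_add_mul_ediv (x₀ * q % k) w
      have e3 : x * q % k / w = x₀ * q % k / w := hx2.trans hx₀2.symm
      have e4 := Int.emod_nonneg (x * q % k) hw0.ne'
      have e5 := Int.emod_nonneg (x₀ * q % k) hw0.ne'
      have e6 := Int.emod_lt_of_pos (x * q % k) hw0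
      have e7 := Int.emod_lt_of_pos (x₀ * q % k) hw0
      rw [e3] at e1
      rw [abs_le]; constructor <;> linarith
    rw [h1, ← hwR]
    exact_mod_cast h2
  have h71 : R * R ^ 70 ≤ R ^ 134 := by
    rw [← pow_succ']; exact pow_le_pow_right₀ (by linarith) (by norm_num)
  have htq : |(t : ℝ) * q| ≤ R ^ 134 := by
    rw [abs_of_nonneg (by positivity)]
    refine le_trans ?_ h71
    gcongr
  have hγ1 : |(((x - x₀ + t) * q + Yv * k : ℤ) : ℝ)| ≤ 2 * R ^ 134 := by
    have : (((x - x₀ + t) * q + Yv * k : ℤ) : ℝ) =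
        (((x - x₀) * q + Yv * k : ℤ) : ℝ) + t * q := by push_cast; ring
    rw [this]
    refine (abs_add_le _ _).trans ?_
    linarith
  have h135 : 300 * R ^ 134 ≤ R ^ 135 := by
    rw [pow_succ' R 134]; gcongr; linarith
  have hRle : R ≤ R ^ 204 := le_self_pow₀ (by linarith) (by norm_num)
  have hxt : |((x - x₀ + t : ℤ) : ℝ)| ≤ 2 * R ^ 204 := by
    have : ((x - x₀ + t : ℤ) : ℝ) = ((x - x₀ : ℤ) : ℝ) + t := by push_cast; ring
    rw [this]
    refine (abs_add_le _ _).trans ?_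
    rw [Nat.abs_cast]
    linarith
  have hp134 := hRp 134
  refine ⟨hxt, by linarith, ?_, ?_⟩
  · have h1 : (k : ℝ) * (((x - x₀ + t) * ρ + Yv * l : ℤ) : ℝ) =
        -(((x - x₀ + t : ℤ) : ℝ) * (q * l - k * ρ)) +
          l * (((x - x₀ + t) * q + Yv * k : ℤ) : ℝ) := by
      push_cast; ring
    have h2 : |((x - x₀ + t : ℤ) : ℝ) * (q * l - k * ρ)| ≤ 2 * R ^ 134 * k := by
      rw [abs_mul]
      calc |((x - x₀ + t : ℤ) : ℝ)| * |(q * l - k * ρ : ℝ)|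
          ≤ 2 * R ^ 204 * |(q * l - k * ρ : ℝ)| := by gcongr
        _ = 2 * R ^ 134 * (|(q * l - k * ρ : ℝ)| * R ^ 70) := by ring
        _ ≤ 2 * R ^ 134 * k := by gcongr
    have h3 : |(l : ℝ) * (((x - x₀ + t) * q + Yv * k : ℤ) : ℝ)| ≤ 128 * k * (2 * R ^ 134) := by
      rw [abs_mul, abs_of_pos hlpos]
      gcongr
      linarith
    have h4 : (k : ℝ) * |(((x - x₀ + t) * ρ + Yv * l : ℤ) : ℝ)| ≤ k * (258 * R ^ 134) := by
      rw [← abs_of_pos hkpos, ← abs_mul, abs_of_pos hkpos, h1]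
      refine (abs_add_le _ _).trans ?_
      rw [abs_neg]
      linarith
    have := le_of_mul_le_mul_left h4 hkpos
    linarith
  · have h1 : (k : ℝ) * Yv = (((x - x₀) * q + Yv * k : ℤ) : ℝ) - ((x - x₀ : ℤ) : ℝ) * q := by
      push_cast; ring
    have h2 : |((x - x₀ : ℤ) : ℝ) * q| ≤ R ^ 134 * (8 * k) := by
      rw [abs_mul, abs_of_pos hq0R]
      calc |((x - x₀ : ℤ) : ℝ)| * q ≤ R ^ 204 * R ^ 70 := by gcongr
        _ = R ^ 134 * R ^ 140 := by ring
        _ ≤ R ^ 134 * (8 * k) := by gcongr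
    have hk1 : (1 : ℝ) ≤ k := by exact_mod_cast hk0
    have h4 : (k : ℝ) * |(Yv : ℝ)| ≤ k * (9 * R ^ 134) := by
      rw [← abs_of_pos hkpos, ← abs_mul, abs_of_pos hkpos, h1]
      refine (abs_sub _ _).trans ?_
      nlinarith
    have := le_of_mul_le_mul_left h4 hkpos
    linarith

theorem pow_le_exp_mul {x y : ℝ} (hx : 0 ≤ x) (h : x ≤ exp y) (n : ℕ) : x ^ n ≤ exp (n * y) := by
  rw [exp_nat_mul]
  exact pow_le_pow_left₀ hx h n

set_option maxHeartbeats 1000000 in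
theorem false_of_small_linear_form {a b : ℕ} (ha : ¬IsSquare a) (hb : ¬IsSquare b)
    (hab : ¬IsSquare (a * b)) {r : ℕ} (hr : 10 ^ 6 * (1 + log r) ≤ r)
    {e e' h h' G₁ G₂ : Bool × Bool → ℝ}
    (he : e ∈ biquadInt a b) (he' : e' ∈ biquadInt a b) (hh : h ∈ biquadInt a b)
    (hh' : h' ∈ biquadInt a b) (hG₁ : G₁ ∈ biquadInt a b) (hG₂ : G₂ ∈ biquadInt a b)
    (hee : ∀ s, e s * e' s = 1) (hhh : ∀ s, h s * h' s = 1)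
    (heU : ∀ s, |e s| ≤ exp ((r : ℝ) ^ 60)) (heU' : ∀ s, |e' s| ≤ exp ((r : ℝ) ^ 60))
    (hhU : ∀ s, |h s| ≤ exp ((r : ℝ) ^ 60)) (hhU' : ∀ s, |h' s| ≤ exp ((r : ℝ) ^ 60))
    (hGU₁ : ∀ s, |G₁ s| ≤ exp ((r : ℝ) ^ 60)) (hGU₂ : ∀ s, |G₂ s| ≤ exp ((r : ℝ) ^ 60))
    {l₁ l₂ g₁ g₂ : ℝ} (hl₁ : e (true, true) = exp l₁) (hl₂ : h (true, true) = exp l₂)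
    (hg₁ : G₁ (true, true) = exp g₁) (hg₂ : G₂ (true, true) = exp g₂)
    (hl₂U : |l₂| ≤ (r : ℝ) ^ 60) (hg₁U : |g₁| ≤ (r : ℝ) ^ 60) (hg₂U : |g₂| ≤ (r : ℝ) ^ 60)
    {k l : ℤ} (hk : (r : ℝ) ^ 140 ≤ 8 * k) (hk' : (k : ℝ) ≤ 16 * (r : ℝ) ^ 140) (hl : 0 < l)
    (hl' : (l : ℝ) ≤ 16 * (r : ℝ) ^ 140)
    (hindep : ∀ q ρ : ℤ, q ≠ 0 → q * l₁ ≠ ρ * l₂)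
    (hΛ : |k * l₁ - l * l₂ + (g₁ - g₂)| ≤ exp (-(r : ℝ) ^ 200)) : False := by
  set R : ℝ := (r : ℝ) with hR
  have hr0 : 0 < r := by
    rcases Nat.eq_zero_or_pos r with h0 | h0
    · rw [hR, h0] at hr; norm_num at hr
    · exact h0
  have hRge1 : 1 ≤ R := by rw [hR]; exact_mod_cast hr0
  have hlog0 : 0 ≤ log R := log_nonneg hRge1
  have hR6 : (10 : ℝ) ^ 6 ≤ R := by linarith
  have hr1000 : 1000 ≤ r := by
    have : (1000 : ℝ) ≤ (r : ℝ) := by rw [← hR]; linarith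
    exact_mod_cast this
  have hRpos : 0 < R := by linarith
  have hRp : ∀ m, 0 < R ^ m := fun m => by positivity
  have hRmono : ∀ {i j : ℕ}, i ≤ j → R ^ i ≤ R ^ j := fun hij => pow_le_pow_right₀ hRge1 hij
  have hRexp : ∀ m : ℕ, R ^ m = exp (m * log R) := fun m => by
    rw [exp_nat_mul, exp_log hRpos]
  obtain ⟨q, ρ, S, Y, hq0, hqR, hdio, hScard, hS⟩ := exists_lattice_points hr1000 hk hk' hl hl'
  set Λ : ℝ := k * l₁ - l * l₂ + (g₁ - g₂) with hΛdef
  set φ : ℝ := q * l₁ - ρ * l₂ with hφdef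
  have hφ0 : φ ≠ 0 := sub_ne_zero.2 (hindep q ρ hq0.ne')
  have hkpos : (0 : ℝ) < k := by have := hRp 140; linarith
  have hq0R : (0 : ℝ) < q := by exact_mod_cast hq0
  have hΛ1 : |Λ| ≤ 1 := hΛ.trans (exp_le_one_iff.2 (by have := hRp 200; linarith))
  have hφle : |φ| * R ^ 10 ≤ 25 := by
    have h1 : k * φ = q * (Λ - g₁ + g₂) + (q * l - k * ρ) * l₂ := by
      rw [hφdef, hΛdef]; ring
    have h60 : 1 ≤ R ^ 60 := one_le_pow₀ hRge1
    have h2 : |Λ - g₁ + g₂| ≤ 3 * R ^ 60 := by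
      rw [abs_le] at *
      constructor <;> linarith
    have h3 : k * |φ| ≤ R ^ 70 * (3 * R ^ 60) + |(q * l - k * ρ : ℝ)| * R ^ 60 := by
      rw [← abs_of_pos hkpos, ← abs_mul, abs_of_pos hkpos, h1]
      refine (abs_add_le _ _).trans ?_
      rw [abs_mul, abs_mul, abs_of_pos hq0R]
      gcongr
    have h4 : k * (|φ| * R ^ 10) ≤ k * 25 := by
      calc k * (|φ| * R ^ 10) = k * |φ| * R ^ 10 := by ring
        _ ≤ (R ^ 70 * (3 * R ^ 60) + |(q * l - k * ρ : ℝ)| * R ^ 60) * R ^ 10 := by gcongr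
        _ = 3 * R ^ 140 + |(q * l - k * ρ : ℝ)| * R ^ 70 := by ring
        _ ≤ k * 25 := by linarith
    exact le_of_mul_le_mul_left h4 hkpos
  have h197 : R * R ^ 196 = R ^ 197 := by ring
  have hlogR : log R ≤ R := by linarith
  refine false_of_many_points ha hb hab (E := {z : ℤ × ℤ | |(z.1 : ℝ)| ≤ 2 * R ^ 204 ∧
      |((z.1 * q + z.2 * k : ℤ) : ℝ)| ≤ R ^ 135 ∧ |((z.1 * ρ + z.2 * l : ℤ) : ℝ)| ≤ R ^ 135 ∧
      |(z.2 : ℝ)| ≤ R ^ 135}) (K := 8 * r ^ 196) (L := r) (n := r ^ 197) (φ := φ) (Λ := Λ)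
    (M := 2 * R ^ 204) (T := R ^ 196) (V := R ^ 197 / 27) (δ := R ^ 136 * exp (-R ^ 200))
    (S := S) (Y := Y) hφ0 ?_ (fun z hz => hz.1) ?_ ?_ ?_ ?_ (fun x hx t ht => hS x hx t ht)
    (by positivity) (le_of_eq (by ring)) (lt_of_eq_of_lt (by ring) hScard) ?_ ?_ ?_ ?_ ?_ ?_
  · have : 1 ≤ R ^ 204 := one_le_pow₀ hRge1
    linarith
  · rintro ⟨x, y⟩ ⟨hx, hx₁, hx₂, hy⟩
    obtain ⟨f, D, hD, hf⟩ := exists_integral_powers he he' hh hh' hG₁ hG₂ hee hhh (hRp 60).le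
      heU heU' hhU hhU' hGU₁ hGU₂ hl₁ hl₂ hg₁ hg₂ (Γ := R ^ 135) r (c₁ := x * q + y * k)
      (c₂ := -(x * ρ + y * l)) (c₃ := y) hx₁ (by rw [Int.cast_neg, abs_neg]; exact hx₂) hy
    refine ⟨f, D, hD, fun j hj => ?_⟩
    obtain ⟨h1, h2, h3⟩ := hf j hj
    refine ⟨h1, fun s => (h2 s).trans (exp_le_exp.2 ?_), ?_⟩
    · calc 3 * R * R ^ 135 * R ^ 60 = 3 * R ^ 196 := by ring
        _ ≤ R ^ 197 / 27 := by rw [← h197]; nlinarith [hRp 196]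
    · rw [h3]
      congr 3
      rw [hφdef, hΛdef]
      push_cast
      ring
  · calc R * |φ| * (2 * R ^ 204) = 2 * R ^ 195 * (|φ| * R ^ 10) := by ring
      _ ≤ 2 * R ^ 195 * 25 := by gcongr
      _ ≤ R * R ^ 195 := by nlinarith [hRp 195]
      _ = R ^ 196 := by ring
  · rw [hRexp 136, ← exp_add, exp_le_one_iff]
    have : R * 136 ≤ R ^ 200 := by
      calc R * 136 ≤ R * R := by gcongr; linarith
        _ = R ^ 2 := by ring
        _ ≤ R ^ 200 := hRmono (by norm_num)
    push_cast
    nlinarith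
  · rintro ⟨x, y⟩ ⟨hx, hx₁, hx₂, hy⟩
    rw [abs_mul]
    calc R * (|(y : ℝ)| * |Λ|) ≤ R * (R ^ 135 * exp (-R ^ 200)) := by gcongr
      _ = R ^ 136 * exp (-R ^ 200) := by ring
  · push_cast
    calc 8 * R ^ 196 * R = 8 * R ^ 197 := by ring
      _ ≤ R * R ^ 197 := by gcongr; linarith
      _ = R ^ 198 := by ring
      _ ≤ exp (R ^ 197 / 27) := by
        rw [hRexp 198, exp_le_exp]
        push_cast
        have : R ^ 1 ≤ R ^ 196 := hRmono (by norm_num)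
        have := hRp 196
        nlinarith
  · have hM : 2 * R ^ 204 ≤ exp (205 * log R) := by
      have := hRexp 205
      push_cast at this
      rw [← this, pow_succ]
      nlinarith [hRp 204]
    refine (pow_le_exp_mul (by positivity) hM _).trans (exp_le_exp.2 ?_)
    rw [Nat.cast_mul, Nat.cast_pow, ← hR, ← h197]
    push_cast
    nlinarith [hRp 196]
  · rw [← h197]; nlinarith [hRp 196]
  · push_cast; linarith
  · push_cast
    have h3 : exp 3 ≤ 27 := by
      have : exp 3 = exp 1 ^ 3 := by rw [← exp_nat_mul]; norm_num
      rw [this]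
      calc exp 1 ^ 3 ≤ 3 ^ 3 := by gcongr; exact exp_one_lt_d9.le.trans (by norm_num)
        _ = 27 := by norm_num
    calc 2 * (8 * R ^ 196 + R ^ 196) * exp 3 ≤ 2 * (8 * R ^ 196 + R ^ 196) * 27 := by gcongr
      _ ≤ R * R ^ 196 := by nlinarith [hRp 196]
      _ = R ^ 197 := h197
  · push_cast
    have hM : 2 * (2 * R ^ 204) ≤ exp (205 * log R) := by
      have := hRexp 205
      push_cast at this
      rw [← this, pow_succ]
      nlinarith [hRp 204]
    have h1 : (2 * (2 * R ^ 204)) ^ (r ^ 197) ≤ exp (R ^ 197 * (205 * log R)) := by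
      have := pow_le_exp_mul (by positivity) hM (r ^ 197)
      rwa [Nat.cast_pow, ← hR] at this
    have h2 : R ^ 197 * (2 * (2 * R ^ 204)) ^ (r ^ 197) + 1 ≤
        2 * (R ^ 197 * exp (R ^ 197 * (205 * log R))) := by
      have h3 : 1 ≤ R ^ 197 * exp (R ^ 197 * (205 * log R)) :=
        one_le_mul_of_one_le_of_one_le (one_le_pow₀ hRge1)
          (one_le_exp (mul_nonneg (hRp 197).le (mul_nonneg (by norm_num) hlog0)))
      have h4 : R ^ 197 * (2 * (2 * R ^ 204)) ^ (r ^ 197) ≤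
        R ^ 197 * exp (R ^ 197 * (205 * log R)) := mul_le_mul_of_nonneg_left h1 (hRp 197).le
      linarith
    have h16 : (16 : ℝ) ≤ exp (log R) := by rw [exp_log hRpos]; linarith
    have hfin : 334 * log R + R ^ 197 * (205 * log R) + R ^ 197 ≤ R ^ 200 := by
      have e1 : log R ≤ R ^ 197 := hlogR.trans (le_self_pow₀ hRge1 (by norm_num))
      have e2 : R ^ 197 * log R ≤ R ^ 197 * R := by gcongr
      have e3 : R ^ 200 = R ^ 197 * R * (R * R) := by ring
      have e4 : R ^ 197 ≤ R ^ 197 * R := le_mul_of_one_le_right (hRp 197).le hRge1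
      have e5 : R ^ 197 * R * 1000 ≤ R ^ 197 * R * (R * R) := by
        gcongr; nlinarith
      linarith [hRp 198]
    calc (R ^ 197 * (2 * (2 * R ^ 204)) ^ (r ^ 197) + 1) * (2 * (R ^ 136 * exp (-R ^ 200))) *
          exp (27 * (R ^ 197 / 27))
        ≤ 2 * (R ^ 197 * exp (R ^ 197 * (205 * log R))) * (2 * (R ^ 136 * exp (-R ^ 200))) *
          exp (27 * (R ^ 197 / 27)) := by gcongr
      _ = 1 / 4 * (16 * exp (333 * log R + R ^ 197 * (205 * log R) + R ^ 197 - R ^ 200)) := by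
        rw [show 333 * log R + R ^ 197 * (205 * log R) + R ^ 197 - R ^ 200 =
          (197 : ℕ) * log R + R ^ 197 * (205 * log R) + ((136 : ℕ) * log R + -R ^ 200) +
          27 * (R ^ 197 / 27) by push_cast; ring, exp_add, exp_add, exp_add, exp_add, ← hRexp,
          ← hRexp]
        ring
      _ ≤ 1 / 4 * (exp (log R) *
          exp (333 * log R + R ^ 197 * (205 * log R) + R ^ 197 - R ^ 200)) := by gcongr
      _ ≤ 1 / 4 * 1 := by
        rw [← exp_add]
        gcongr
        rw [exp_le_one_iff]
        linarith
      _ = 1 / 4 := by ring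

/-- Composing two coprime solutions of `x² - Dy² = m` with the same slope modulo `m`. -/
theorem exists_pell_of_same_class {D x y x' y' m b : ℤ} (hm : m ≠ 0) (h : x ^ 2 - D * y ^ 2 = m)
    (h' : x' ^ 2 - D * y' ^ 2 = m) (hxy : IsCoprime x y) (hxy' : IsCoprime x' y')
    (hb : m ∣ x - b * y) (hb' : m ∣ x' - b * y') (hy : 0 < y) (hy' : 0 < y')
    (hne : ¬(x = x' ∧ y = y')) :
    ∃ X Y : ℤ, m * X = x * x' - D * y * y' ∧ m * Y = x' * y - x * y' ∧ Y ≠ 0 ∧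
      X ^ 2 - D * Y ^ 2 = 1 := by
  obtain ⟨Y, hY⟩ : m ∣ x' * y - x * y' := by
    have e : x' * y - x * y' = (x' - b * y') * y - (x - b * y) * y' := by ring
    rw [e]
    exact dvd_sub (hb'.mul_right y) (hb.mul_right y')
  have hcop : IsCoprime m y := by
    have h1 : IsCoprime (x ^ 2) y := hxy.pow_left
    have : x ^ 2 = m + (D * y) * y := by rw [← h]; ring
    rw [this] at h1
    exact (IsCoprime.add_mul_right_left_iff).1 h1
  obtain ⟨X, hX⟩ : m ∣ x * x' - D * y * y' := by
    have h1 : y * (x * x' - D * y * y') = x * (x' * y - x * y') + (x ^ 2 - D * y ^ 2) * y' := by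
      ring
    have h2 : m ∣ y * (x * x' - D * y * y') := by
      rw [h1, h, hY]
      exact dvd_add ((dvd_mul_right m Y).mul_left x) (dvd_mul_right m y')
    exact hcop.dvd_of_dvd_mul_left h2
  refine ⟨X, Y, hX.symm, hY.symm, ?_, ?_⟩
  · rintro rfl
    have e : x' * y = x * y' := by linarith
    have d1 : y ∣ y' := hxy.symm.dvd_of_dvd_mul_left ⟨x', by linarith⟩
    have d2 : y' ∣ y := hxy'.symm.dvd_of_dvd_mul_left ⟨x, by linarith⟩
    have e2 : y = y' := Int.dvd_antisymm hy.le hy'.le d1 d2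
    subst e2
    exact hne ⟨(mul_right_cancel₀ hy.ne' e).symm, rfl⟩
  · have h1 : m ^ 2 * (X ^ 2 - D * Y ^ 2) = m ^ 2 * 1 := by
      calc m ^ 2 * (X ^ 2 - D * Y ^ 2) = (m * X) ^ 2 - D * (m * Y) ^ 2 := by ring
        _ = (x ^ 2 - D * y ^ 2) * (x' ^ 2 - D * y' ^ 2) := by rw [← hX, ← hY]; ring
        _ = m ^ 2 * 1 := by rw [h, h']; ring
    exact mul_left_cancel₀ (pow_ne_zero 2 hm) h1

theorem exists_slope {m x y : ℤ} (hm : m ≠ 0) (h : IsCoprime y m) :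
    ∃ b, 0 ≤ b ∧ b < |m| ∧ m ∣ x - b * y := by
  obtain ⟨u, v, huv⟩ := h
  refine ⟨x * u % m, Int.emod_nonneg _ hm, Int.emod_lt_abs _ hm, ?_⟩
  have h1 := Int.emod_add_mul_ediv (x * u) m
  refine ⟨x * v + (x * u / m) * y, ?_⟩
  linear_combination (-x) * huv + (-y) * h1

/-- Pell's equation has a nontrivial solution of controlled size. -/
theorem exists_pell_le {D : ℕ} (hD : ¬IsSquare D) :
    ∃ x y : ℕ, 0 < y ∧ (x : ℤ) ^ 2 - D * (y : ℤ) ^ 2 = 1 ∧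
      (x : ℝ) + y * √D ≤ exp (202 * D * log (3 * D)) := by
  have hD2 : 2 ≤ D := by
    by_contra! h
    interval_cases D
    · exact hD ⟨0, rfl⟩
    · exact hD ⟨1, rfl⟩
  have hD2R : (2 : ℝ) ≤ D := by exact_mod_cast hD2
  have hsq : √(D : ℝ) * √D = D := mul_self_sqrt (by positivity)
  have hs1 : 1 ≤ √(D : ℝ) := by rw [one_le_sqrt]; linarith
  have hsD : √(D : ℝ) ≤ D := by nlinarith
  set w : ℝ := √(D : ℝ) with hw
  set Q : ℕ := 3 * D with hQ
  set N : ℕ := 100 * D with hN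
  have hQ0 : 0 < Q := by omega
  have happ : ∀ i : ℕ, ∃ q : ℚ, |w - q| ≤ 1 / (((Q ^ i : ℕ) + 1) * q.den) ∧ q.den ≤ Q ^ i :=
    fun i => Real.exists_rat_abs_sub_le_and_den_le w (by positivity)
  choose q hq hqd using happ
  have hden : ∀ i, (1 : ℝ) ≤ (q i).den := fun i => by exact_mod_cast (q i).den_pos
  have hdenQ : ∀ i, ((q i).den : ℝ) ≤ (Q : ℝ) ^ i := fun i => by exact_mod_cast hqd i
  have hQi : ∀ i, (1 : ℝ) ≤ (Q : ℝ) ^ i := fun i => (hden i).trans (hdenQ i)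
  have hlin : ∀ i, |(q i).num - (q i).den * w| * ((Q : ℝ) ^ i + 1) ≤ 1 := by
    intro i
    have h1 := hq i
    have h2 : ((q i : ℚ) : ℝ) = (q i).num / (q i).den := by
      exact_mod_cast (Rat.num_div_den (q i)).symm
    have h0 : (0 : ℝ) < (q i).den := by linarith [hden i]
    rw [h2, abs_sub_comm, le_div_iff₀ (by positivity)] at h1
    push_cast at h1
    calc |(q i).num - (q i).den * w| * ((Q : ℝ) ^ i + 1)
        = |((q i).num / (q i).den - w) * (q i).den| * ((Q : ℝ) ^ i + 1) := by
          congr 2; field_simp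
      _ = |((q i).num : ℝ) / (q i).den - w| * (((Q : ℝ) ^ i + 1) * (q i).den) := by
          rw [abs_mul, abs_of_pos h0]; ring
      _ ≤ 1 := h1
  have hlin1 : ∀ i, |(q i).num - (q i).den * w| ≤ 1 := fun i => by
    have := hlin i
    nlinarith [abs_nonneg ((q i).num - (q i).den * w), hQi i]
  have hnum : ∀ i, |((q i).num : ℝ)| + (q i).den * w ≤ 2 * ((q i).den * w) + 1 := by
    intro i
    have h1 := abs_sub_abs_le_abs_sub ((q i).num : ℝ) ((q i).den * w)
    rw [abs_of_nonneg (by positivity : 0 ≤ ((q i).den : ℝ) * w)] at h1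
    linarith [hlin1 i]
  set m : ℕ → ℤ := fun i => (q i).num ^ 2 - D * ((q i).den : ℤ) ^ 2 with hm
  have hmR : ∀ i, (m i : ℝ) = ((q i).num - (q i).den * w) * ((q i).num + (q i).den * w) := by
    intro i
    simp only [hm]
    push_cast
    rw [← hsq]; ring
  have hm0 : ∀ i, m i ≠ 0 := by
    intro i h0
    have h1 : ((q i).num / (q i).den : ℚ) ^ 2 = D := by
      have h2 : ((q i).num : ℚ) ^ 2 = D * ((q i).den : ℚ) ^ 2 := by
        have := sub_eq_zero.1 h0
        exact_mod_cast this
      have h3 : ((q i).den : ℚ) ≠ 0 := by exact_mod_cast (q i).den_nz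
      rw [div_pow, h2]; field_simp
    exact hD (Rat.isSquare_natCast_iff.1 ⟨_, by rw [← h1, sq]⟩)
  have hmabs : ∀ i, |(m i : ℝ)| ≤ |(q i).num - (q i).den * w| * (2 * ((q i).den * w) + 1) := by
    intro i
    rw [hmR, abs_mul]
    refine mul_le_mul_of_nonneg_left ?_ (abs_nonneg _)
    refine (abs_add_le _ _).trans ?_
    rw [abs_of_nonneg (by positivity : 0 ≤ ((q i).den : ℝ) * w)]
    exact hnum i
  have hmle : ∀ i, |(m i : ℝ)| ≤ 2 * w + 1 := by
    intro i
    refine (hmabs i).trans ?_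
    have h1 : 2 * ((q i).den * w) + 1 ≤ ((Q : ℝ) ^ i + 1) * (2 * w + 1) := by
      have := mul_le_mul_of_nonneg_right (hdenQ i) (by positivity : 0 ≤ w)
      nlinarith [hQi i]
    calc |(q i).num - (q i).den * w| * (2 * ((q i).den * w) + 1)
        ≤ |(q i).num - (q i).den * w| * (((Q : ℝ) ^ i + 1) * (2 * w + 1)) := by gcongr
      _ = |(q i).num - (q i).den * w| * ((Q : ℝ) ^ i + 1) * (2 * w + 1) := by ring
      _ ≤ 1 * (2 * w + 1) := by gcongr; exact hlin i
      _ = 2 * w + 1 := one_mul _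
  have hinj : ∀ i j, i < j → q i ≠ q j := by
    intro i j hij hqq
    have h1 : (1 : ℝ) ≤ |(m j : ℝ)| := by
      exact_mod_cast Int.one_le_abs (hm0 j)
    have h2 := hmabs j
    have h3 := hlin j
    have h4 : (q j).den ≤ (Q : ℝ) ^ i := by rw [← hqq]; exact hdenQ i
    have h5 : (Q : ℝ) ^ (i + 1) ≤ (Q : ℝ) ^ j :=
      pow_le_pow_right₀ (by exact_mod_cast hQ0) hij
    have h6 : (Q : ℝ) ^ j + 1 ≤ 2 * ((q j).den * w) + 1 := by
      by_contra! hlt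
      have hpos : 0 < |(q j).num - (q j).den * w| := by
        by_contra! h0
        have : (0 : ℝ) ≤ 2 * ((q j).den * w) + 1 := by positivity
        nlinarith
      nlinarith
    have h7 : (Q : ℝ) ^ (i + 1) = (Q : ℝ) ^ i * (3 * D) := by rw [pow_succ, hQ]; push_cast; ring
    have h8 : (q j).den * w ≤ (Q : ℝ) ^ i * D := by gcongr
    nlinarith [hQi i]
  have hcop : ∀ i, IsCoprime (q i).num ((q i).den : ℤ) := fun i => by
    rw [Int.isCoprime_iff_gcd_eq_one]
    exact (q i).reduced
  have hcopm : ∀ i, IsCoprime ((q i).den : ℤ) (m i) := fun i => by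
    have h1 : IsCoprime ((q i).num ^ 2) ((q i).den : ℤ) := (hcop i).pow_left
    have : (q i).num ^ 2 = m i + (D * (q i).den) * (q i).den := by simp only [hm]; ring
    rw [this] at h1
    exact ((IsCoprime.add_mul_right_left_iff).1 h1).symm
  choose b hb0 hblt hb using fun i => exists_slope (x := (q i).num) (hm0 i) (hcopm i)
  set B : ℤ := 2 * (Nat.sqrt D : ℤ) + 3 with hB
  have hmB : ∀ i, |m i| ≤ B := by
    intro i
    have h1 := hmle i
    have h2 : w ≤ Nat.sqrt D + 1 := by
      rw [hw]
      exact Real.real_sqrt_le_nat_sqrt_succ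
    have h3 : |(m i : ℝ)| ≤ ((B : ℤ) : ℝ) := by rw [hB]; push_cast; linarith
    exact_mod_cast h3
  obtain ⟨i, hi, j, hj, hij, hclass⟩ := Finset.exists_ne_map_eq_of_card_lt_of_maps_to
    (s := Finset.range N) (t := Finset.Icc (-B) B ×ˢ Finset.Ico 0 B) (f := fun i => (m i, b i))
    (by
      rw [Finset.card_product, Int.card_Icc, Int.card_Ico, Finset.card_range]
      have h1 : Nat.sqrt D * Nat.sqrt D ≤ D := Nat.sqrt_le D
      have h2 : 0 < Nat.sqrt D := Nat.sqrt_pos.2 (by omega)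
      have e1 : (B + 1 - -B).toNat = 4 * Nat.sqrt D + 7 := by omega
      have e2 : (B - 0).toNat = 2 * Nat.sqrt D + 3 := by omega
      rw [e1, e2]
      nlinarith)
    (by
      intro i _
      have := hmB i
      simp only [Finset.coe_product, Set.mem_prod, Finset.mem_coe, Finset.mem_Icc, Finset.mem_Ico]
      exact ⟨abs_le.1 this, hb0 i, (hblt i).trans_le this⟩)
  obtain ⟨hmm, hbb⟩ := Prod.mk.inj hclass
  have hqne : q i ≠ q j := by
    rcases lt_or_gt_of_ne hij with h | h
    · exact hinj i j h
    · exact (hinj j i h).symm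
  obtain ⟨X, Y, hX, hY, hY0, hXY⟩ :=
      exists_pell_of_same_class (hm0 i) rfl hmm.symm (hcop i) (hcop j)
    (hb i) (by rw [hbb, hmm]; exact hb j) (by exact_mod_cast (q i).den_pos)
    (by exact_mod_cast (q j).den_pos) (fun h => hqne (Rat.ext h.1 (by exact_mod_cast h.2)))
  refine ⟨X.natAbs, Y.natAbs, Int.natAbs_pos.2 hY0, by simpa using hXY, ?_⟩
  have hsize : ∀ i ∈ Finset.range N, |((q i).num : ℝ)| + (q i).den * w ≤ (Q : ℝ) ^ N := by
    intro i hi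
    have h1 : (Q : ℝ) ^ (i + 1) ≤ (Q : ℝ) ^ N :=
      pow_le_pow_right₀ (by exact_mod_cast hQ0) (Finset.mem_range.1 hi)
    have h7 : (Q : ℝ) ^ (i + 1) = (Q : ℝ) ^ i * (3 * D) := by rw [pow_succ, hQ]; push_cast; ring
    have h8 : (q i).den * w ≤ (Q : ℝ) ^ i * D :=
      mul_le_mul (hdenQ i) hsD (by positivity) (by positivity)
    nlinarith [hnum i, hQi i]
  have h1 : (1 : ℝ) ≤ |(m i : ℝ)| := by exact_mod_cast Int.one_le_abs (hm0 i)
  have hXR : |(m i : ℝ)| * |(X : ℝ)| ≤ |((q i).num : ℝ)| * |((q j).num : ℝ)| +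
      (q i).den * w * ((q j).den * w) := by
    have e : (m i : ℝ) * X = (q i).num * (q j).num - (q i).den * w * ((q j).den * w) := by
      have : (m i : ℝ) * X = (q i).num * (q j).num - D * (q i).den * (q j).den := by
        exact_mod_cast hX
      rw [this, ← hsq]; ring
    rw [← abs_mul, e, ← abs_mul]
    refine (abs_sub _ _).trans ?_
    rw [abs_of_nonneg (by positivity : 0 ≤ ((q i).den : ℝ) * w * ((q j).den * w))]
  have hYR : |(m i : ℝ)| * |(Y : ℝ)| ≤ |((q j).num : ℝ)| * (q i).den +
      |((q i).num : ℝ)| * (q j).den := by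
    have e : (m i : ℝ) * Y = (q j).num * (q i).den - (q i).num * (q j).den := by
      exact_mod_cast hY
    rw [← abs_mul, e]
    refine (abs_sub _ _).trans ?_
    rw [abs_mul, abs_mul, Nat.abs_cast, Nat.abs_cast]
  have hfin : |(X : ℝ)| + |(Y : ℝ)| * w ≤ (Q : ℝ) ^ N * (Q : ℝ) ^ N := by
    have hz : 0 ≤ |(X : ℝ)| + |(Y : ℝ)| * w := by positivity
    calc |(X : ℝ)| + |(Y : ℝ)| * w ≤ |(m i : ℝ)| * (|(X : ℝ)| + |(Y : ℝ)| * w) :=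
          le_mul_of_one_le_left hz h1
      _ = |(m i : ℝ)| * |(X : ℝ)| + |(m i : ℝ)| * |(Y : ℝ)| * w := by ring
      _ ≤ (|((q i).num : ℝ)| * |((q j).num : ℝ)| + (q i).den * w * ((q j).den * w)) +
          (|((q j).num : ℝ)| * (q i).den + |((q i).num : ℝ)| * (q j).den) * w := by gcongr
      _ = (|((q i).num : ℝ)| + (q i).den * w) * (|((q j).num : ℝ)| + (q j).den * w) := by ring
      _ ≤ (Q : ℝ) ^ N * (Q : ℝ) ^ N :=
          mul_le_mul (hsize i hi) (hsize j hj) (by positivity) (by positivity)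
  rw [Nat.cast_natAbs, Nat.cast_natAbs, Int.cast_abs, Int.cast_abs]
  refine hfin.trans ?_
  have hQexp : (Q : ℝ) = exp (log (3 * D)) := by
    rw [exp_log (by positivity), hQ]; push_cast; ring
  rw [← pow_add, hQexp, ← exp_nat_mul, exp_le_exp]
  have : 0 ≤ log (3 * (D : ℝ)) := log_nonneg (by linarith)
  rw [hN]; push_cast
  nlinarith [mul_nonneg (by positivity : (0:ℝ) ≤ D) this]

theorem exists_mul_exp_eq {D : ℕ} {x y : ℤ} {u : ℝ} (hx : (x : ℝ) + y * √D = exp u)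
    (hy : (x : ℝ) - y * √D = exp (-u)) (p t : ℤ) (k : ℕ) :
    ∃ p' t' : ℤ, (p' : ℝ) + t' * √D = (p + t * √D) * exp (k * u) ∧
      (p' : ℝ) - t' * √D = (p - t * √D) * exp (-(k * u)) := by
  have hsq : √(D : ℝ) * √D = D := mul_self_sqrt (by positivity)
  induction k with
  | zero => exact ⟨p, t, by simp, by simp⟩
  | succ k ih =>
    obtain ⟨p', t', h1, h2⟩ := ih
    refine ⟨p' * x + t' * y * D, p' * y + t' * x, ?_, ?_⟩
    · have e : (p + t * √D) * exp (((k + 1 : ℕ) : ℝ) * u) = (p' + t' * √D) * (x + y * √D) := by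
        rw [h1, hx, mul_assoc, ← exp_add]; push_cast; ring_nf
      rw [e]; push_cast; linear_combination (-(t' * y : ℝ)) * hsq
    · have e : (p - t * √D) * exp (-(((k + 1 : ℕ) : ℝ) * u)) = (p' - t' * √D) * (x - y * √D) := by
        rw [h2, hy, mul_assoc, ← exp_add]; push_cast; ring_nf
      rw [e]; push_cast; linear_combination (-(t' * y : ℝ)) * hsq

/-- A real quadratic order has units in a prescribed range of sizes. -/
theorem exists_unit_between {D : ℕ} (hD : ¬IsSquare D) {W : ℝ}
    (hW : 404 * D * log (3 * D) ≤ W) :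
    ∃ (x y : ℤ) (u : ℝ), (x : ℝ) + y * √D = exp u ∧ (x : ℝ) - y * √D = exp (-u) ∧
      0 < u ∧ W / 2 ≤ u ∧ u ≤ W := by
  obtain ⟨x, y, hy, hxy, hle⟩ := exists_pell_le hD
  have hsq : √(D : ℝ) * √D = D := mul_self_sqrt (by positivity)
  have hxy' : (x : ℝ) ^ 2 - D * (y : ℝ) ^ 2 = 1 := by exact_mod_cast hxy
  have hyR : (1 : ℝ) ≤ y := by exact_mod_cast hy
  have hs1 := one_le_sqrt_of_nonsquare hD
  have hx1 : (1 : ℝ) ≤ x := by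
    have h1 : (1 : ℝ) ≤ (x : ℝ) ^ 2 := by nlinarith [(by positivity : (0 : ℝ) ≤ D * (y : ℝ) ^ 2)]
    nlinarith [(by positivity : (0 : ℝ) ≤ x)]
  have hE1 : (1 : ℝ) < x + y * √D := by nlinarith
  set v : ℝ := log (x + y * √D) with hv
  have hv0 : 0 < v := log_pos hE1
  have hvW : v ≤ W / 2 := by
    have : v ≤ 202 * D * log (3 * D) := by
      rw [hv, log_le_iff_le_exp (by linarith)]
      exact hle
    linarith
  have hexp : ((x : ℤ) : ℝ) + ((y : ℤ) : ℝ) * √D = exp v := by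
    rw [hv, exp_log (by linarith)]; push_cast; rfl
  have hexp' : ((x : ℤ) : ℝ) - ((y : ℤ) : ℝ) * √D = exp (-v) := by
    rw [exp_neg, ← hexp]
    refine eq_inv_of_mul_eq_one_left ?_
    push_cast
    linear_combination hxy' - (y : ℝ) ^ 2 * hsq
  obtain ⟨X, Y, h1, h2⟩ := exists_mul_exp_eq hexp hexp' 1 0 ⌊W / v⌋₊
  have hfl : (⌊W / v⌋₊ : ℝ) * v ≤ W := by
    have := Nat.floor_le (div_nonneg (by linarith) hv0.le : 0 ≤ W / v)
    rwa [le_div_iff₀ hv0] at this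
  have hfl' : W < (⌊W / v⌋₊ + 1 : ℝ) * v := by
    have := Nat.lt_floor_add_one (W / v)
    rwa [div_lt_iff₀ hv0] at this
  refine ⟨X, Y, ⌊W / v⌋₊ * v, by simpa using h1, by simpa using h2, ?_, ?_, hfl⟩ <;> linarith

/-- Dividing a number with small norm by a power of a unit of size about `exp W`. -/
theorem exists_unit_factorization {D : ℕ} (hD : ¬IsSquare D) {W : ℝ}
    (hW : 404 * D * log (3 * D) ≤ W) {p t : ℤ} (h1 : 1 ≤ (p : ℝ) + t * √D)
    (hnorm : |((p : ℝ) + t * √D) * (p - t * √D)| ≤ exp W) :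
    ∃ (x y p' t' : ℤ) (u g : ℝ) (k : ℕ), (x : ℝ) + y * √D = exp u ∧
      (x : ℝ) - y * √D = exp (-u) ∧ 0 < u ∧ W / 2 ≤ u ∧ u ≤ W ∧ (p' : ℝ) + t' * √D = exp g ∧
      0 ≤ g ∧ g ≤ W ∧ |(p' : ℝ) - t' * √D| ≤ exp W ∧ log (p + t * √D) = k * u + g := by
  obtain ⟨x, y, u, hx, hy, hu, hWu, huW⟩ := exists_unit_between hD hW
  set ℓ : ℝ := log (p + t * √D) with hℓ
  have hℓ0 : 0 ≤ ℓ := log_nonneg h1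
  set k : ℕ := ⌊ℓ / u⌋₊ with hk
  have hfl : (k : ℝ) * u ≤ ℓ := by
    have := Nat.floor_le (by positivity : 0 ≤ ℓ / u)
    rwa [le_div_iff₀ hu] at this
  have hfl' : ℓ < (k + 1 : ℝ) * u := by
    have := Nat.lt_floor_add_one (ℓ / u)
    rwa [div_lt_iff₀ hu] at this
  have hx' : (x : ℝ) + ((-y : ℤ) : ℝ) * √D = exp (-u) := by rw [← hy]; push_cast; ring
  have hy' : (x : ℝ) - ((-y : ℤ) : ℝ) * √D = exp (-(-u)) := by
    rw [neg_neg, ← hx]; push_cast; ring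
  obtain ⟨p', t', hp, ht⟩ := exists_mul_exp_eq hx' hy' p t k
  have hα : (p : ℝ) + t * √D = exp ℓ := by rw [hℓ, exp_log (by linarith)]
  refine ⟨x, y, p', t', u, ℓ - k * u, k, hx, hy, hu, hWu, huW, ?_, by linarith, by linarith, ?_,
    by ring⟩
  · rw [hp, hα, ← exp_add]; ring_nf
  · rw [ht, abs_mul, abs_of_pos (exp_pos _)]
    refine le_trans ?_ hnorm
    rw [abs_mul, abs_of_pos (by linarith : 0 < (p : ℝ) + t * √D), mul_comm]
    refine mul_le_mul_of_nonneg_right ?_ (abs_nonneg _)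
    rw [hα, exp_le_exp]
    linarith

/-- Units of norm one in different real quadratic orders are multiplicatively independent. -/
theorem mul_log_unit_ne {a b : ℕ} (hb : b ≠ 0) (hab : ¬IsSquare (a * b)) {x y x' y' : ℤ} {u v : ℝ}
    (hx : (x : ℝ) + y * √a = exp u) (hy : (x : ℝ) - y * √a = exp (-u)) (hu : 0 < u)
    (hx' : (x' : ℝ) + y' * √b = exp v) (hy' : (x' : ℝ) - y' * √b = exp (-v)) (hv : 0 < v)
    (q ρ : ℤ) (hq : q ≠ 0) : q * u ≠ ρ * v := by
  intro h
  have key : ∀ q ρ : ℕ, q ≠ 0 → q * u ≠ ρ * v := by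
    intro q ρ hq h
    obtain ⟨A, B, hA, hB⟩ := exists_mul_exp_eq hx hy 1 0 q
    obtain ⟨A', B', hA', hB'⟩ := exists_mul_exp_eq hx' hy' 1 0 ρ
    simp only [Int.cast_one, Int.cast_zero, zero_mul, add_zero, one_mul, sub_zero] at hA hB hA' hB'
    rw [← h] at hA' hB'
    have e1 : (B : ℝ) * √a = B' * √b := by linarith
    have hqa : √(a : ℝ) * √a = a := mul_self_sqrt (by positivity)
    have hqb : √(b : ℝ) * √b = b := mul_self_sqrt (by positivity)
    have e2 : (b * B' : ℤ) ^ 2 = (a * b : ℕ) * B ^ 2 := by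
      have : ((b * B' : ℤ) ^ 2 : ℝ) = (a * b : ℕ) * (B : ℝ) ^ 2 := by
        push_cast
        calc ((b : ℝ) * B') ^ 2 = b * (B' * √b) ^ 2 := by
              rw [mul_pow _ (√(b : ℝ)), sq √(b : ℝ), hqb]; ring
          _ = b * (B * √a) ^ 2 := by rw [e1]
          _ = a * b * (B : ℝ) ^ 2 := by rw [mul_pow _ (√(a : ℝ)), sq √(a : ℝ), hqa]; ring
      exact_mod_cast this
    have hB0 := (Int.eq_zero_of_sq_eq_nonsquare_mul_sq hab e2).2
    rw [hB0] at hA hB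
    have e3 : exp (q * u) = exp (-(q * u)) := by rw [← hA, ← hB]; simp
    have e4 : (q : ℝ) * u = -(q * u) := exp_injective e3
    have e5 : 0 < (q : ℝ) * u := by positivity
    linarith
  have hρ : ∀ ρ : ℤ, (0 : ℝ) < ρ * v → 0 < ρ := fun ρ h => by
    exact_mod_cast pos_of_mul_pos_left h hv.le
  rcases lt_or_gt_of_ne hq with h0 | h0
  · have hqR : (q : ℝ) < 0 := by exact_mod_cast h0
    have h1 : 0 < -ρ := hρ (-ρ) (by push_cast; nlinarith)
    obtain ⟨q', hq'⟩ := Int.eq_ofNat_of_zero_le (show 0 ≤ -q by omega)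
    obtain ⟨ρ', hρ'⟩ := Int.eq_ofNat_of_zero_le h1.le
    refine key q' ρ' (by omega) ?_
    have e1 : (q' : ℝ) = -q := by exact_mod_cast hq'.symm
    have e2 : (ρ' : ℝ) = -ρ := by exact_mod_cast hρ'.symm
    rw [e1, e2]; linarith
  · have hqR : (0 : ℝ) < q := by exact_mod_cast h0
    have h1 : 0 < ρ := hρ ρ (by rw [← h]; positivity)
    obtain ⟨q', rfl⟩ := Int.eq_ofNat_of_zero_le h0.le
    obtain ⟨ρ', rfl⟩ := Int.eq_ofNat_of_zero_le h1.le
    exact key q' ρ' (by omega) (by exact_mod_cast h)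

theorem abs_add_mul_signedSqrt_le {D : ℕ} {p t B : ℝ} (h : |p + t * √D| ≤ B)
    (h' : |p - t * √D| ≤ B) (s : Bool) : |p + t * signedSqrt D s| ≤ B := by
  cases s
  · simpa [signedSqrt, sub_eq_add_neg] using h'
  · simpa [signedSqrt] using h

theorem bounds_of_eq_mul_add {A W k u g x : ℝ} (hA : 1 ≤ A) (hW : 0 < W) (hk : 0 ≤ k)
    (h : x = k * u + g) (hg : 0 ≤ g) (hgW : g ≤ W) (hWu : W / 2 ≤ u) (huW : u ≤ W)
    (hx : 2 * (A * W) ≤ x) (hx' : x ≤ 8 * (A * W)) : A ≤ k ∧ k ≤ 16 * A := by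
  constructor
  · have : A * W ≤ k * W := by nlinarith
    exact le_of_mul_le_mul_right this hW
  · have : k * W ≤ 16 * A * W := by nlinarith
    exact le_of_mul_le_mul_right this hW

/-- Two numbers of small norm from different real quadratic fields are not too close. -/
theorem false_of_close_logs {a b : ℕ} (ha : ¬IsSquare a) (hb : ¬IsSquare b)
    (hab : ¬IsSquare (a * b)) {r : ℕ} (hr : 10 ^ 6 * (1 + log r) ≤ r)
    (haW : 404 * a * log (3 * a) ≤ (r : ℝ) ^ 60) (hbW : 404 * b * log (3 * b) ≤ (r : ℝ) ^ 60)
    {p t p' t' : ℤ} (hα : 2 * (r : ℝ) ^ 200 ≤ log (p + t * √a))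
    (hα' : log (p + t * √a) ≤ 8 * (r : ℝ) ^ 200)
    (hβ : 2 * (r : ℝ) ^ 200 ≤ log (p' + t' * √b)) (hβ' : log (p' + t' * √b) ≤ 8 * (r : ℝ) ^ 200)
    (h1 : 1 ≤ (p : ℝ) + t * √a) (h1' : 1 ≤ (p' : ℝ) + t' * √b)
    (hnorm : |((p : ℝ) + t * √a) * (p - t * √a)| ≤ exp ((r : ℝ) ^ 60))
    (hnorm' : |((p' : ℝ) + t' * √b) * (p' - t' * √b)| ≤ exp ((r : ℝ) ^ 60))
    (hclose : |log (p + t * √a) - log (p' + t' * √b)| ≤ exp (-(r : ℝ) ^ 200)) : False := by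
  have hb0 : b ≠ 0 := fun h => hb (h ▸ ⟨0, rfl⟩)
  have hr1 : (1 : ℝ) ≤ r := by
    rcases Nat.eq_zero_or_pos r with h0 | h0
    · rw [h0] at hr; norm_num at hr
    · exact_mod_cast h0
  obtain ⟨x, y, P, T, u, g, k, hx, hy, hu, hWu, huW, hg, hg0, hgW, hG, hk⟩ :=
    exists_unit_factorization ha haW h1 hnorm
  obtain ⟨x', y', P', T', u', g', k', hx', hy', hu', hWu', huW', hg', hg0', hgW', hG', hk'⟩ :=
    exists_unit_factorization hb hbW h1' hnorm'
  set R : ℝ := (r : ℝ) with hR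
  have hRp : 0 < R ^ 60 := by positivity
  have h200 : R ^ 200 = R ^ 140 * R ^ 60 := by ring
  have h140 : 1 ≤ R ^ 140 := one_le_pow₀ hr1
  rw [h200] at hα hα' hβ hβ'
  obtain ⟨hk1, hk2⟩ := bounds_of_eq_mul_add h140 hRp (Nat.cast_nonneg k) hk hg0 hgW hWu huW hα hα'
  obtain ⟨hk1', hk2'⟩ := bounds_of_eq_mul_add h140 hRp (Nat.cast_nonneg k') hk' hg0' hgW' hWu' huW'
    hβ hβ'
  have hk0' : (0 : ℝ) < k' := by linarith
  have hbd : ∀ {v}, 0 < v → v ≤ R ^ 60 → |exp v| ≤ exp (R ^ 60) ∧ |exp (-v)| ≤ exp (R ^ 60) := by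
    intro v h0 h
    rw [abs_of_pos (exp_pos _), abs_of_pos (exp_pos _), exp_le_exp, exp_le_exp]
    constructor <;> linarith
  have hn : ∀ {x y : ℤ} {D : ℕ} {v}, (x : ℝ) + y * √D = exp v → (x : ℝ) - y * √D = exp (-v) →
      (x : ℝ) + (-y : ℤ) * √D = exp (-v) ∧ (x : ℝ) - (-y : ℤ) * √D = exp v := by
    intro x y D v h h'
    rw [← h, ← h']; push_cast
    constructor <;> ring
  have hunit : ∀ {x y : ℤ} {D : ℕ} {v}, (x : ℝ) + y * √D = exp v → (x : ℝ) - y * √D = exp (-v) →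
      ∀ s, ((x : ℝ) + y * signedSqrt D s) * (x + (-y : ℤ) * signedSqrt D s) = 1 := by
    intro x y D v h h' s
    have e1 : (x : ℝ) ^ 2 - y ^ 2 * D = 1 := by
      have : ((x : ℝ) + y * √D) * (x - y * √D) = 1 := by rw [h, h', ← exp_add]; simp
      have hs : √(D : ℝ) * √D = D := mul_self_sqrt (by positivity)
      linear_combination this + (y : ℝ) ^ 2 * hs
    rw [← e1, ← signedSqrt_mul_self D s]; push_cast; ring
  refine false_of_small_linear_form ha hb hab hr
    (left_mem_biquadInt a b x y) (left_mem_biquadInt a b x (-y))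
    (right_mem_biquadInt a b x' y') (right_mem_biquadInt a b x' (-y'))
    (left_mem_biquadInt a b P T) (right_mem_biquadInt a b P' T')
    (fun s => hunit hx hy s.1) (fun s => hunit hx' hy' s.2)
    (fun s => abs_add_mul_signedSqrt_le (by rw [hx]; exact (hbd hu huW).1)
      (by rw [hy]; exact (hbd hu huW).2) s.1)
    (fun s => abs_add_mul_signedSqrt_le (by rw [(hn hx hy).1]; exact (hbd hu huW).2)
      (by rw [(hn hx hy).2]; exact (hbd hu huW).1) s.1)
    (fun s => abs_add_mul_signedSqrt_le (by rw [hx']; exact (hbd hu' huW').1)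
      (by rw [hy']; exact (hbd hu' huW').2) s.2)
    (fun s => abs_add_mul_signedSqrt_le (by rw [(hn hx' hy').1]; exact (hbd hu' huW').2)
      (by rw [(hn hx' hy').2]; exact (hbd hu' huW').1) s.2)
    (fun s => abs_add_mul_signedSqrt_le
      (by rw [hg, abs_of_pos (exp_pos _), exp_le_exp]; exact hgW) hG s.1)
    (fun s => abs_add_mul_signedSqrt_le
      (by rw [hg', abs_of_pos (exp_pos _), exp_le_exp]; exact hgW') hG' s.2)
    (l₁ := u) (l₂ := u') (g₁ := g) (g₂ := g') (by simpa [signedSqrt] using hx)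
    (by simpa [signedSqrt] using hx') (by simpa [signedSqrt] using hg)
    (by simpa [signedSqrt] using hg') (by rw [abs_of_pos hu']; exact huW')
    (by rw [abs_of_nonneg hg0]; exact hgW) (by rw [abs_of_nonneg hg0']; exact hgW')
    (k := k) (l := k') (by push_cast; linarith) (by push_cast; exact hk2) (by exact_mod_cast hk0')
    (by push_cast; exact hk2') (mul_log_unit_ne hb0 hab hx hy hu hx' hy' hu') ?_
  rw [hk, hk'] at hclose
  push_cast
  convert hclose using 2
  ring

theorem abs_log_sub_log_le {x y z : ℝ} (hz : 0 < z) (hx : z ≤ x) (hy : z ≤ y) :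
    |log x - log y| ≤ |x - y| / z := by
  have key : ∀ {x y : ℝ}, z ≤ x → z ≤ y → log x - log y ≤ |x - y| / z := by
    intro x y hx hy
    have hx0 : 0 < x := hz.trans_le hx
    have hy0 : 0 < y := hz.trans_le hy
    rw [← log_div hx0.ne' hy0.ne']
    calc log (x / y) ≤ x / y - 1 := log_le_sub_one_of_pos (by positivity)
      _ = (x - y) / y := by field_simp
      _ ≤ |x - y| / y := by gcongr; exact le_abs_self _
      _ ≤ |x - y| / z := by gcongr
  rw [abs_sub_le_iff]
  exact ⟨key hx hy, by rw [abs_sub_comm]; exact key hy hx⟩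

theorem abs_log_sub_log_le_of_add_eq {x x' y y' P Z : ℝ} (hZ : 0 < Z) (hx : Z ≤ x) (hy : Z ≤ y)
    (hP : |x * x'| ≤ P) (hP' : |y * y'| ≤ P) (h : x + x' = y + y') :
    |log x - log y| ≤ 2 * P / Z ^ 2 := by
  have key : ∀ {x x' : ℝ}, Z ≤ x → |x * x'| ≤ P → |x'| ≤ P / Z := by
    intro x x' hx hP
    rw [le_div_iff₀ hZ, mul_comm]
    rw [abs_mul, abs_of_pos (hZ.trans_le hx)] at hP
    exact (mul_le_mul_of_nonneg_right hx (abs_nonneg _)).trans hP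
  have h1 : |x - y| ≤ P / Z + P / Z := by
    rw [show x - y = y' - x' by linarith]
    exact (abs_sub _ _).trans (add_le_add (key hy hP') (key hx hP))
  calc |log x - log y| ≤ |x - y| / Z := abs_log_sub_log_le hZ hx hy
    _ ≤ (P / Z + P / Z) / Z := by gcongr
    _ = 2 * P / Z ^ 2 := by field_simp; ring

/-- The numbers `h₃ (h₂ t₁ + t₂ √(h₁ h₂))` have small norm and moderate size. -/
theorem bounds_of_sq_eq {h₁ h₂ h₃ c X t₁ t₂ H s : ℝ} (hh₁ : 1 ≤ h₁) (hh₂ : 1 ≤ h₂) (hh₃ : 1 ≤ h₃)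
    (hH₁ : h₁ ≤ H) (hH₂ : h₂ ≤ H) (hH₃ : h₃ ≤ H) (ht₁0 : 0 ≤ t₁) (ht₂0 : 0 ≤ t₂) (hX : 0 ≤ X)
    (ht₁ : t₁ ^ 2 = h₁ * X + h₁ ^ 2 + c ^ 2) (ht₂ : t₂ ^ 2 = h₂ * X + h₂ ^ 2 + c ^ 2)
    (hs0 : 0 ≤ s) (hs : s ^ 2 = h₁ * h₂) (hXH : 4 * H ^ 4 * (H * X + H ^ 2 + c ^ 2) ≤ X ^ 2) :
    |(h₃ * h₂ * t₁ + h₃ * t₂ * s) * (h₃ * h₂ * t₁ - h₃ * t₂ * s)| ≤ H ^ 4 * (c ^ 2 + H ^ 2) ∧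
    √X ≤ h₃ * h₂ * t₁ + h₃ * t₂ * s ∧ h₃ * h₂ * t₁ + h₃ * t₂ * s ≤ X := by
  have hH0 : 0 ≤ H := by linarith
  refine ⟨?_, ?_, ?_⟩
  · have e : (h₃ * h₂ * t₁ + h₃ * t₂ * s) * (h₃ * h₂ * t₁ - h₃ * t₂ * s) =
        h₃ ^ 2 * h₂ * (h₂ - h₁) * (c ^ 2 - h₁ * h₂) := by
      linear_combination h₃ ^ 2 * h₂ ^ 2 * ht₁ - h₃ ^ 2 * (h₁ * h₂) * ht₂ -
        h₃ ^ 2 * t₂ ^ 2 * hs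
    rw [e, abs_mul, abs_mul, abs_of_nonneg (by positivity : 0 ≤ h₃ ^ 2 * h₂)]
    have h1 : |h₂ - h₁| ≤ H := by rw [abs_le]; constructor <;> linarith
    have h2 : |c ^ 2 - h₁ * h₂| ≤ c ^ 2 + H ^ 2 := by
      have h3 : h₁ * h₂ ≤ H ^ 2 := by rw [sq]; gcongr
      have h4 : 0 ≤ h₁ * h₂ := by positivity
      rw [abs_le]; constructor <;> nlinarith [sq_nonneg c, sq_nonneg H]
    calc h₃ ^ 2 * h₂ * |h₂ - h₁| * |c ^ 2 - h₁ * h₂| ≤ H ^ 2 * H * H * (c ^ 2 + H ^ 2) := by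
          gcongr
      _ = H ^ 4 * (c ^ 2 + H ^ 2) := by ring
  · have h1 : √X ≤ t₁ := by
      rw [Real.sqrt_le_left ht₁0, ht₁]
      nlinarith [sq_nonneg c, sq_nonneg h₁]
    have h2 : 1 ≤ h₃ * h₂ := one_le_mul_of_one_le_of_one_le hh₃ hh₂
    have h3 : 0 ≤ h₃ * t₂ * s := by positivity
    nlinarith
  · have hb : ∀ {h t}, 1 ≤ h → h ≤ H → t ^ 2 = h * X + h ^ 2 + c ^ 2 →
        t ^ 2 ≤ H * X + H ^ 2 + c ^ 2 := by
      intro h t h1 h2 h3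
      rw [h3]; gcongr
    have h1 : h₃ * h₂ * t₁ ≤ X / 2 := by
      refine abs_le_of_sq_le_sq' ?_ (by positivity) |>.2
      calc (h₃ * h₂ * t₁) ^ 2 = h₃ ^ 2 * h₂ ^ 2 * t₁ ^ 2 := by ring
        _ ≤ H ^ 2 * H ^ 2 * (H * X + H ^ 2 + c ^ 2) := by gcongr; exact hb hh₁ hH₁ ht₁
        _ ≤ (X / 2) ^ 2 := by nlinarith
    have h2 : h₃ * t₂ * s ≤ X / 2 := by
      refine abs_le_of_sq_le_sq' ?_ (by positivity) |>.2
      calc (h₃ * t₂ * s) ^ 2 = h₃ ^ 2 * (h₁ * h₂) * t₂ ^ 2 := by rw [← hs]; ring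
        _ ≤ H ^ 2 * (H * H) * (H * X + H ^ 2 + c ^ 2) := by gcongr; exact hb hh₂ hH₂ ht₂
        _ ≤ (X / 2) ^ 2 := by nlinarith
    linarith

theorem Nat.isSquare_of_isSquare_sq_mul {h m : ℕ} (hh : h ≠ 0) (H : IsSquare (h ^ 2 * m)) :
    IsSquare m := by
  obtain ⟨w, hw⟩ := H
  have h1 : h ^ 2 ∣ w ^ 2 := ⟨m, by rw [hw]; ring⟩
  obtain ⟨v, rfl⟩ := (Nat.pow_dvd_pow_iff two_ne_zero).1 h1
  refine ⟨v, Nat.eq_of_mul_eq_mul_left (by positivity : 0 < h ^ 2) ?_⟩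
  rw [hw]; ring

theorem false_of_three_squares {h₁ h₂ h₃ t₁ t₂ t₃ c X r : ℕ} (hh₁ : 0 < h₁) (hh₂ : 0 < h₂)
    (hh₃ : 0 < h₃) (ht₁ : t₁ ^ 2 = h₁ * X + h₁ ^ 2 + c ^ 2)
    (ht₂ : t₂ ^ 2 = h₂ * X + h₂ ^ 2 + c ^ 2) (ht₃ : t₃ ^ 2 = h₃ * X + h₃ ^ 2 + c ^ 2)
    (h₁₂ : ¬IsSquare (h₁ * h₂)) (h₁₃ : ¬IsSquare (h₁ * h₃)) (h₂₃ : ¬IsSquare (h₂ * h₃))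
    {H : ℝ} (hH₁ : (h₁ : ℝ) ≤ H) (hH₂ : (h₂ : ℝ) ≤ H) (hH₃ : (h₃ : ℝ) ≤ H)
    (hr : 10 ^ 6 * (1 + log r) ≤ r) (hW : 404 * H ^ 2 * log (3 * H ^ 2) ≤ (r : ℝ) ^ 60)
    (hcH : H ^ 4 * ((c : ℝ) ^ 2 + H ^ 2) ≤ exp ((r : ℝ) ^ 60))
    (hXH : 4 * H ^ 4 * (H * X + H ^ 2 + (c : ℝ) ^ 2) ≤ (X : ℝ) ^ 2)
    (hX0 : 0 < X) (hXr : 4 * (r : ℝ) ^ 200 ≤ log X) (hXr' : log X ≤ 8 * (r : ℝ) ^ 200) : False := by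
  have hXR : (0 : ℝ) < X := by exact_mod_cast hX0
  have hr1 : (1 : ℝ) ≤ r := by
    rcases Nat.eq_zero_or_pos r with h0 | h0
    · rw [h0] at hr; norm_num at hr
    · exact_mod_cast h0
  have hH0 : 0 ≤ H := (Nat.cast_nonneg _).trans hH₁
  have one_le : ∀ {h : ℕ}, 0 < h → (1 : ℝ) ≤ h := fun h => by exact_mod_cast h
  have cast : ∀ {h t : ℕ}, t ^ 2 = h * X + h ^ 2 + c ^ 2 →
      (t : ℝ) ^ 2 = h * X + (h : ℝ) ^ 2 + (c : ℝ) ^ 2 := fun h => by exact_mod_cast h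
  have hsq : ∀ h h' : ℕ, √((h * h' : ℕ) : ℝ) ^ 2 = (h : ℝ) * h' := fun h h' => by
    rw [sq_sqrt (by positivity)]; push_cast; rfl
  obtain ⟨hα1, hα2, hα3⟩ := bounds_of_sq_eq (one_le hh₁) (one_le hh₂) (one_le hh₃) hH₁ hH₂ hH₃
    (Nat.cast_nonneg _) (Nat.cast_nonneg _) hXR.le (cast ht₁) (cast ht₂) (sqrt_nonneg _)
    (hsq h₁ h₂) hXH
  obtain ⟨hβ1, hβ2, hβ3⟩ := bounds_of_sq_eq (one_le hh₁) (one_le hh₃) (one_le hh₂) hH₁ hH₃ hH₂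
    (Nat.cast_nonneg _) (Nat.cast_nonneg _) hXR.le (cast ht₁) (cast ht₃) (sqrt_nonneg _)
    (hsq h₁ h₃) hXH
  set R : ℝ := (r : ℝ) with hR
  have h200 : 1 ≤ R ^ 200 := one_le_pow₀ hr1
  have h60 : R ^ 60 ≤ R ^ 200 := pow_le_pow_right₀ hr1 (by norm_num)
  have hX1 : 1 ≤ √(X : ℝ) := by rw [one_le_sqrt]; exact one_le hX0
  have hab : ¬IsSquare (h₁ * h₂ * (h₁ * h₃)) := fun h =>
    h₂₃ (Nat.isSquare_of_isSquare_sq_mul hh₁.ne' (by convert h using 1; ring))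
  have hlogW : ∀ {h h' : ℕ}, 0 < h → 0 < h' → (h : ℝ) ≤ H → (h' : ℝ) ≤ H →
      404 * ((h * h' : ℕ) : ℝ) * log (3 * ((h * h' : ℕ) : ℝ)) ≤ R ^ 60 := by
    intro h h' h0 h0' hh hh'
    refine le_trans ?_ hW
    have e1 : ((h * h' : ℕ) : ℝ) ≤ H ^ 2 := by
      push_cast; rw [sq]; gcongr
    have e2 : (1 : ℝ) ≤ ((h * h' : ℕ) : ℝ) := one_le (by positivity)
    have e3 : 0 ≤ log (3 * ((h * h' : ℕ) : ℝ)) := log_nonneg (by linarith)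
    gcongr
  have hlog : ∀ {x : ℝ}, √(X : ℝ) ≤ x → x ≤ X → 2 * R ^ 200 ≤ log x ∧ log x ≤ 8 * R ^ 200 := by
    intro x hx hx'
    have e1 : log √(X : ℝ) ≤ log x := log_le_log (by linarith) hx
    have e2 : log x ≤ log X := log_le_log (by linarith) hx'
    rw [log_sqrt hXR.le] at e1
    constructor <;> linarith
  have hclose := abs_log_sub_log_le_of_add_eq (by linarith) hα2 hβ2 hα1 hβ1 (by ring)
  refine false_of_close_logs h₁₂ h₁₃ hab hr (hlogW hh₁ hh₂ hH₁ hH₂) (hlogW hh₁ hh₃ hH₁ hH₃)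
    (p := h₃ * h₂ * t₁) (t := h₃ * t₂) (p' := h₂ * h₃ * t₁) (t' := h₂ * t₃)
    ?_ ?_ ?_ ?_ ?_ ?_ ?_ ?_ ?_ <;> push_cast at *
  · exact (hlog hα2 hα3).1
  · exact (hlog hα2 hα3).2
  · exact (hlog hβ2 hβ3).1
  · exact (hlog hβ2 hβ3).2
  · linarith
  · linarith
  · exact hα1.trans hcH
  · exact hβ1.trans hcH
  · refine hclose.trans ?_
    rw [sq_sqrt hXR.le, div_le_iff₀ hXR]
    have e1 : exp (4 * R ^ 200) ≤ X := by
      rw [← le_log_iff_exp_le hXR]; exact hXr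
    have e2 : (2 : ℝ) ≤ exp 1 := by linarith [add_one_le_exp (1 : ℝ)]
    calc 2 * (H ^ 4 * ((c : ℝ) ^ 2 + H ^ 2)) ≤ exp 1 * exp (R ^ 60) := by gcongr
      _ = exp (1 + R ^ 60) := (exp_add _ _).symm
      _ ≤ exp (-R ^ 200 + 4 * R ^ 200) := by rw [exp_le_exp]; linarith
      _ = exp (-R ^ 200) * exp (4 * R ^ 200) := exp_add _ _
      _ ≤ exp (-R ^ 200) * X := by gcongr

/-- A divisor `d` of `n` close to `√n` makes `d + n / d` slightly larger than the sum `S` of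
another factorization, the excess `h` giving a representation of a quadratic form. -/
theorem exists_excess_of_dvd {n S c d : ℕ} {q w : ℝ} (hS : S ^ 2 = 4 * n + c ^ 2) (hq : 0 < q)
    (hqn : q ^ 4 = n) (hc : (c : ℝ) ^ 2 < 4 * q ^ 2) (hw : 2 * w ≤ q) (hd : d ∣ n)
    (hd₁ : q ^ 2 - q * w ≤ d) (hd₂ : d ≤ q ^ 2 + q * w) :
    ∃ h t : ℕ, d + n / d = S + h ∧ (h : ℝ) ≤ 2 * w ^ 2 ∧ t ^ 2 = h * (2 * S) + h ^ 2 + c ^ 2 := by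
  obtain ⟨e, rfl⟩ := hd
  have hdq : q ^ 2 / 2 ≤ d := by nlinarith
  have hd0 : (0 : ℝ) < d := by nlinarith [sq_nonneg q, pow_pos hq 2]
  have hd0' : 0 < d := by exact_mod_cast hd0
  rw [Nat.mul_div_cancel_left _ hd0']
  have hqn' : q ^ 4 = d * e := by rw [hqn]; push_cast; rfl
  have hSR : (S : ℝ) ^ 2 = 4 * q ^ 4 + (c : ℝ) ^ 2 := by rw [hqn]; exact_mod_cast hS
  have hid : ((d : ℝ) - q ^ 2) ^ 2 = d * (d + e - 2 * q ^ 2) := by linear_combination hqn'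
  have hlow : 0 ≤ (d : ℝ) + e - 2 * q ^ 2 := by
    by_contra! hlt
    nlinarith [sq_nonneg ((d : ℝ) - q ^ 2)]
  have hup : (d : ℝ) + e - 2 * q ^ 2 ≤ 2 * w ^ 2 := by
    have h1 : ((d : ℝ) - q ^ 2) ^ 2 ≤ (q * w) ^ 2 := by
      refine sq_le_sq' ?_ ?_ <;> linarith
    have h2 : q ^ 2 / 2 * (d + e - 2 * q ^ 2) ≤ q ^ 2 / 2 * (2 * w ^ 2) := by
      calc q ^ 2 / 2 * (d + e - 2 * q ^ 2) ≤ d * (d + e - 2 * q ^ 2) := by gcongr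
        _ ≤ (q * w) ^ 2 := by rw [← hid]; exact h1
        _ = q ^ 2 / 2 * (2 * w ^ 2) := by ring
    exact le_of_mul_le_mul_left h2 (by positivity)
  have hS1 : 2 * q ^ 2 ≤ S := by
    refine abs_le_of_sq_le_sq' ?_ (by positivity) |>.2
    rw [hSR]; nlinarith [sq_nonneg (c : ℝ)]
  have hS2 : (S : ℝ) < 2 * q ^ 2 + 1 := by
    refine abs_lt_of_sq_lt_sq' ?_ (by positivity) |>.2
    rw [hSR]; nlinarith
  have hSs : S ≤ d + e := by
    have : (S : ℝ) < ((d + e + 1 : ℕ) : ℝ) := by push_cast; linarith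
    exact Nat.lt_succ_iff.1 (by exact_mod_cast this)
  obtain ⟨h, hh⟩ := Nat.exists_eq_add_of_le hSs
  have hhR : (d : ℝ) + e = S + h := by exact_mod_cast hh
  refine ⟨h, ((d : ℤ) - e).natAbs, hh, by linarith, ?_⟩
  zify at hh hS ⊢
  rw [sq_abs]
  linear_combination (d + e + S + h : ℤ) * hh + hS

theorem card_le_two_of_add_div_eq {n s : ℕ} (T : Finset ℕ)
    (hT : ∀ d ∈ T, 0 < d ∧ d ∣ n ∧ d + n / d = s) : T.card ≤ 2 := by
  rcases T.eq_empty_or_nonempty with rfl | ⟨d, hd⟩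
  · simp
  refine (Finset.card_le_card (t := {d, n / d}) fun x hx => ?_).trans Finset.card_le_two
  obtain ⟨hd0, ⟨e, rfl⟩, hs⟩ := hT d hd
  obtain ⟨hx0, ⟨f, hf⟩, hs'⟩ := hT x hx
  rw [Nat.mul_div_cancel_left _ hd0] at hs ⊢
  rw [hf, Nat.mul_div_cancel_left _ hx0] at hs'
  have h1 : ((x : ℤ) - d) * (x - e) = 0 := by
    zify at hf hs hs'
    linear_combination x * hs' - x * hs + hf
  rw [Finset.mem_insert, Finset.mem_singleton]
  rcases mul_eq_zero.1 h1 with h | h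
  · left; omega
  · right; omega

theorem exists_three_not_isSquare_mul {T : Finset ℕ} (hT : 5 ≤ T.card) {m : ℕ}
    (h0 : ∀ x ∈ T, 0 < x) (h : ∀ x ∈ T, ∀ y ∈ T, x ≠ y → IsSquare (x * y) → x * y = m) :
    ∃ x ∈ T, ∃ y ∈ T, ∃ z ∈ T, ¬IsSquare (x * y) ∧ ¬IsSquare (x * z) ∧ ¬IsSquare (y * z) := by
  have key : ∀ x ∈ T, ∀ y ∈ T, y ≠ x → y ≠ m / x → ¬IsSquare (x * y) := by
    intro x hx y hy h1 h2 hsq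
    exact h2 (by rw [← h x hx y hy h1.symm hsq, Nat.mul_div_cancel_left _ (h0 x hx)])
  obtain ⟨x, hx⟩ : T.Nonempty := Finset.card_pos.1 (by omega)
  obtain ⟨y, hy, hyx⟩ := Finset.exists_mem_notMem_of_card_lt_card (s := {x, m / x}) (t := T)
    (Finset.card_le_two.trans_lt (by omega))
  obtain ⟨z, hz, hzx⟩ := Finset.exists_mem_notMem_of_card_lt_card (s := {x, m / x, y, m / y})
    (t := T) (Finset.card_le_four.trans_lt (by omega))
  simp only [Finset.mem_insert, Finset.mem_singleton, not_or] at hyx hzx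
  exact ⟨x, hx, y, hy, z, hz, key x hx y hy hyx.1 hyx.2, key x hx z hz hzx.1 hzx.2.1,
    key y hy z hz hzx.2.2.1 hzx.2.2.2⟩

theorem mul_eq_sq_of_isSquare {h₁ h₂ t₁ t₂ c X : ℕ} (hh₁ : 0 < h₁) (hh₂ : 0 < h₂)
    (ht₁ : t₁ ^ 2 = h₁ * X + h₁ ^ 2 + c ^ 2) (ht₂ : t₂ ^ 2 = h₂ * X + h₂ ^ 2 + c ^ 2)
    {H : ℝ} (hH₁ : (h₁ : ℝ) ≤ H) (hH₂ : (h₂ : ℝ) ≤ H)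
    (hcH : H ^ 4 * ((c : ℝ) ^ 2 + H ^ 2) < √X)
    (hXH : 4 * H ^ 4 * (H * X + H ^ 2 + (c : ℝ) ^ 2) ≤ (X : ℝ) ^ 2)
    (hne : h₁ ≠ h₂) (hsq : IsSquare (h₁ * h₂)) : h₁ * h₂ = c ^ 2 := by
  obtain ⟨w, hw⟩ := hsq
  obtain ⟨h1, h2, -⟩ := bounds_of_sq_eq (h₃ := 1) (s := w) (c := c) (X := X) (t₁ := t₁) (t₂ := t₂)
    (by exact_mod_cast hh₁ : (1 : ℝ) ≤ h₁) (by exact_mod_cast hh₂ : (1 : ℝ) ≤ h₂) le_rfl hH₁ hH₂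
    (((by exact_mod_cast hh₁ : (1 : ℝ) ≤ h₁)).trans hH₁) (Nat.cast_nonneg _) (Nat.cast_nonneg _)
    (Nat.cast_nonneg _) (by exact_mod_cast ht₁) (by exact_mod_cast ht₂) (Nat.cast_nonneg _)
    (by rw [sq]; exact_mod_cast hw.symm) hXH
  have hzero : (h₂ * t₁ - t₂ * w : ℤ) = 0 := by
    by_contra hne0
    have h3 : (1 : ℝ) ≤ |(1 * h₂ * t₁ - 1 * t₂ * w : ℝ)| := by
      have := Int.one_le_abs hne0
      rw [one_mul, one_mul]
      exact_mod_cast this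
    rw [abs_mul] at h1
    have h4 := (le_abs_self (1 * (h₂ : ℝ) * t₁ + 1 * t₂ * w)).trans
      (le_mul_of_one_le_right (abs_nonneg _) h3)
    linarith [h4.trans h1]
  zify at ht₁ ht₂ hw hne hh₂ ⊢
  have e : (h₂ : ℤ) * ((h₂ - h₁) * (c ^ 2 - h₁ * h₂)) = 0 := by
    linear_combination (h₂ * t₁ + t₂ * w : ℤ) * hzero - (h₂ : ℤ) ^ 2 * ht₁ + (h₁ * h₂ : ℤ) * ht₂ -
      (t₂ : ℤ) ^ 2 * hw
  rcases mul_eq_zero.1 e with h | h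
  · omega
  rcases mul_eq_zero.1 h with h | h
  · exact absurd (by omega) hne
  · linarith

theorem eventually_log_le_mul {ε : ℝ} (hε : 0 < ε) :
    ∀ᶠ x : ℝ in Filter.atTop, log x ≤ ε * x := by
  filter_upwards [Real.isLittleO_log_id_atTop.bound hε, Filter.eventually_ge_atTop 0] with x hx hx0
  rw [Real.norm_eq_abs, Real.norm_eq_abs, id, abs_of_nonneg hx0] at hx
  exact (le_abs_self _).trans hx

theorem add_one_pow_le_two_mul_pow {r : ℝ} {k : ℕ} (hr : 2 * k ≤ r) (hr0 : 0 < r) :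
    (r + 1) ^ k ≤ 2 * r ^ k := by
  have h1 : r + 1 ≤ r * exp (1 / r) := by
    have := add_one_le_exp (1 / r)
    calc r + 1 = r * (1 / r + 1) := by field_simp; ring
      _ ≤ _ := by gcongr
  have h2 : exp (1 / r) ^ k ≤ 2 := by
    rw [← exp_nat_mul, ← Real.le_log_iff_exp_le (by norm_num)]
    have h3 : (k : ℝ) * (1 / r) ≤ 1 / 2 := by
      rw [mul_one_div, div_le_div_iff₀ hr0 (by norm_num)]; linarith
    linarith [Real.log_two_gt_d9]
  calc (r + 1) ^ k ≤ (r * exp (1 / r)) ^ k := by gcongr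
    _ = exp (1 / r) ^ k * r ^ k := by rw [mul_pow, mul_comm]
    _ ≤ _ := by gcongr

theorem eventually_exists_nat_pow_le {k : ℕ} (hk : k ≠ 0) {p : ℕ → Prop}
    (hp : ∀ᶠ r in Filter.atTop, p r) :
    ∀ᶠ g : ℝ in Filter.atTop, ∃ r : ℕ, p r ∧ (r : ℝ) ^ k ≤ g ∧ g ≤ 2 * (r : ℝ) ^ k := by
  have hfloor : Filter.Tendsto (fun g : ℝ => ⌊g ^ (k : ℝ)⁻¹⌋₊) Filter.atTop Filter.atTop :=
    tendsto_nat_floor_atTop.comp (tendsto_rpow_atTop (by positivity))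
  filter_upwards [hfloor.eventually hp, hfloor.eventually_ge_atTop (2 * k),
    Filter.eventually_ge_atTop 0] with g hg hgk hg0
  have hy : (g ^ (k : ℝ)⁻¹) ^ k = g := Real.rpow_inv_natCast_pow hg0 hk
  have hy0 : 0 ≤ g ^ (k : ℝ)⁻¹ := by positivity
  refine ⟨_, hg, ?_, ?_⟩
  · calc (⌊g ^ (k : ℝ)⁻¹⌋₊ : ℝ) ^ k ≤ (g ^ (k : ℝ)⁻¹) ^ k := by
          gcongr; exact Nat.floor_le hy0
      _ = g := hy
  · calc g = (g ^ (k : ℝ)⁻¹) ^ k := hy.symm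
      _ ≤ (⌊g ^ (k : ℝ)⁻¹⌋₊ + 1) ^ k := by gcongr; exact (Nat.lt_floor_add_one _).le
      _ ≤ _ := add_one_pow_le_two_mul_pow (by exact_mod_cast hgk)
          (by exact_mod_cast (by omega : 0 < ⌊g ^ (k : ℝ)⁻¹⌋₊))

theorem eventually_exists_scale :
    ∀ᶠ g : ℝ in Filter.atTop, ∃ r : ℕ, 10 ^ 6 * (1 + log r) ≤ r ∧ 4 * (r : ℝ) ^ 200 ≤ g ∧
      g ≤ 8 * (r : ℝ) ^ 200 := by
  have hp : ∀ᶠ r : ℕ in Filter.atTop, 10 ^ 6 * (1 + log r) ≤ (r : ℝ) := by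
    refine tendsto_natCast_atTop_atTop.eventually (p := fun r : ℝ => 10 ^ 6 * (1 + log r) ≤ r) ?_
    filter_upwards [eventually_log_le_mul (show (0 : ℝ) < 1 / (2 * 10 ^ 6) by norm_num),
      Filter.eventually_ge_atTop (2 * 10 ^ 6 : ℝ)] with x hx hx1
    linarith
  filter_upwards [(Filter.tendsto_id.atTop_div_const (show (0 : ℝ) < 4 by norm_num)).eventually
    (eventually_exists_nat_pow_le (show 200 ≠ 0 by norm_num) hp)] with g ⟨r, hr, h1, h2⟩
  refine ⟨r, hr, ?_, ?_⟩ <;> rw [id] at h1 h2 <;> linarith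

theorem mul_log_le_of_le {z : ℝ} (hz1 : 1 ≤ z) (hz : 4848 * (3 + 20 * log z) ≤ z) :
    404 * (2 * z ^ 10) ^ 2 * log (3 * (2 * z ^ 10) ^ 2) ≤ z ^ 21 / 3 := by
  have h1 : log (3 * (2 * z ^ 10) ^ 2) ≤ 3 + 20 * log z := by
    have e : 3 * (2 * z ^ 10) ^ 2 = 12 * z ^ 20 := by ring
    rw [e, log_mul (by norm_num) (by positivity), log_pow]
    have : log 12 ≤ 3 := by
      rw [Real.log_le_iff_le_exp (by norm_num)]
      have := Real.exp_one_gt_d9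
      calc (12 : ℝ) ≤ 2.7 ^ 3 := by norm_num
        _ ≤ exp 1 ^ 3 := by gcongr; linarith
        _ = exp 3 := by rw [← exp_nat_mul]; norm_num
    push_cast
    linarith
  calc 404 * (2 * z ^ 10) ^ 2 * log (3 * (2 * z ^ 10) ^ 2)
      ≤ 404 * (2 * z ^ 10) ^ 2 * (3 + 20 * log z) := by gcongr
    _ = z ^ 20 * (4848 * (3 + 20 * log z)) / 3 := by ring
    _ ≤ z ^ 20 * z / 3 := by gcongr
    _ = z ^ 21 / 3 := by ring

theorem pow_div_three_le_pow {z r : ℝ} (hr0 : 0 ≤ r)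
    (h : z ^ 70 ≤ 16 * r ^ 200) : z ^ 21 / 3 ≤ r ^ 60 := by
  have h2 : z ^ 21 ≤ 3 * r ^ 60 := by
    refine le_of_pow_le_pow_left₀ (n := 10) (by norm_num) (by positivity) ?_
    have hz : 0 ≤ z ^ 70 := by positivity
    calc (z ^ 21) ^ 10 = (z ^ 70) ^ 3 := by simp only [← pow_mul, Nat.reduceMul]
      _ ≤ (16 * r ^ 200) ^ 3 := by gcongr
      _ = 4096 * r ^ 600 := by rw [mul_pow, ← pow_mul]; norm_num
      _ ≤ 59049 * r ^ 600 := mul_le_mul_of_nonneg_right (by norm_num) (pow_nonneg hr0 _)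
      _ = (3 * r ^ 60) ^ 10 := by rw [mul_pow, ← pow_mul]; norm_num
  linarith

theorem pow_mul_le_exp {z c : ℝ} (hz : 24 ≤ z) (hc0 : 0 ≤ c) (hc : c ≤ 2 * exp (z ^ 20)) :
    (2 * z ^ 10) ^ 4 * (c ^ 2 + (2 * z ^ 10) ^ 2) ≤ exp (z ^ 21 / 3) := by
  have hHE : 2 * z ^ 10 ≤ exp (z ^ 20) := by
    have := add_one_le_exp (z ^ 20)
    have e : z ^ 20 = (z ^ 10) ^ 2 := by ring
    linarith [sq_nonneg (z ^ 10 - 1)]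
  have h5 : 5 ≤ exp (z ^ 20) := by
    have := add_one_le_exp (z ^ 20)
    linarith [le_self_pow₀ (by linarith : 1 ≤ z) (n := 20) (by norm_num)]
  have e8 : exp (z ^ 20) ^ 8 = exp (8 * z ^ 20) := by rw [← exp_nat_mul]; norm_num
  have hH0 : 0 ≤ 2 * z ^ 10 := by positivity
  generalize exp (z ^ 20) = E at *
  calc (2 * z ^ 10) ^ 4 * (c ^ 2 + (2 * z ^ 10) ^ 2) ≤ E ^ 4 * ((2 * E) ^ 2 + E ^ 2) := by gcongr
    _ = 5 * E ^ 6 := by ring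
    _ ≤ E ^ 2 * E ^ 6 := by gcongr; nlinarith
    _ = E ^ 8 := by ring
    _ ≤ exp (z ^ 21 / 3) := by
      rw [e8, exp_le_exp, pow_succ z 20]
      nlinarith [pow_nonneg (by linarith : 0 ≤ z) 20]

theorem exp_pow_div_three_le {z : ℝ} (hz : 2 ≤ z) : exp (z ^ 21 / 3) ≤ exp (z ^ 70 / 4) := by
  rw [exp_le_exp]
  have h1 : 2 ≤ z ^ 49 := hz.trans (le_self_pow₀ (by linarith) (by norm_num))
  have h2 : z ^ 70 = z ^ 49 * z ^ 21 := by ring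
  have h3 : 0 ≤ z ^ 21 := by positivity
  rw [h2]
  generalize z ^ 49 = A at *
  generalize z ^ 21 = B at *
  nlinarith

theorem bounds_of_pow_mul_le {H c P q X : ℝ} (hH : 1 ≤ H)
    (hP : P = H ^ 4 * (c ^ 2 + H ^ 2)) (hPq : P ≤ q) (hq : 2 ≤ q) (hX : 4 * q ^ 2 ≤ X) :
    c ^ 2 < 4 * q ^ 2 ∧ H ≤ q ∧ P < √X ∧ 4 * H ^ 4 * (H * X + H ^ 2 + c ^ 2) ≤ X ^ 2 := by
  have hX0 : 0 < X := lt_of_lt_of_le (by positivity) hX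
  have hH4 : 1 ≤ H ^ 4 := one_le_pow₀ hH
  have hcP : c ^ 2 ≤ P := by
    rw [hP]
    nlinarith [sq_nonneg c, sq_nonneg H, mul_nonneg (sub_nonneg.2 hH4) (sq_nonneg c)]
  have hHP : H ^ 5 ≤ P := by
    calc H ^ 5 ≤ H ^ 6 := by gcongr; norm_num
      _ ≤ P := by rw [hP]; linarith [mul_nonneg (by positivity : 0 ≤ H ^ 4) (sq_nonneg c)]
  have hHP1 : H ≤ P := (le_self_pow₀ hH (n := 5) (by norm_num)).trans hHP
  have hXq : 2 * q ≤ √X := by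
    rw [Real.le_sqrt' (by positivity)]; linarith
  refine ⟨by nlinarith, by linarith, by linarith, ?_⟩
  have h0 : 8 * q ≤ X := by nlinarith
  calc 4 * H ^ 4 * (H * X + H ^ 2 + c ^ 2) = 4 * H ^ 5 * X + 4 * P := by rw [hP]; ring
    _ ≤ 4 * q * X + 4 * q := by
      have := hHP.trans hPq
      have := mul_le_mul_of_nonneg_right this hX0.le
      linarith
    _ ≤ X ^ 2 := by nlinarith

theorem eventually_exists_parameters :
    ∀ᶠ z : ℝ in Filter.atTop, ∀ q c X : ℝ, q = exp (z ^ 70 / 4) → 0 ≤ c →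
      c ≤ 2 * exp (z ^ 20) → 4 * q ^ 2 ≤ X →
      c ^ 2 < 4 * q ^ 2 ∧ 2 * z ^ 5 ≤ q ∧ (2 * z ^ 10) ^ 4 * (c ^ 2 + (2 * z ^ 10) ^ 2) < √X ∧
      4 * (2 * z ^ 10) ^ 4 * (2 * z ^ 10 * X + (2 * z ^ 10) ^ 2 + c ^ 2) ≤ X ^ 2 ∧
      ∃ r : ℕ, 10 ^ 6 * (1 + log r) ≤ r ∧
        404 * (2 * z ^ 10) ^ 2 * log (3 * (2 * z ^ 10) ^ 2) ≤ (r : ℝ) ^ 60 ∧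
        (2 * z ^ 10) ^ 4 * (c ^ 2 + (2 * z ^ 10) ^ 2) ≤ exp ((r : ℝ) ^ 60) ∧
        4 * (r : ℝ) ^ 200 ≤ log X ∧ log X ≤ 8 * (r : ℝ) ^ 200 := by
  obtain ⟨G, hG⟩ := Filter.eventually_atTop.1 eventually_exists_scale
  filter_upwards [eventually_log_le_mul (show (0 : ℝ) < 1 / (4848 * 40) by norm_num),
    Filter.eventually_ge_atTop (4848 * 6 : ℝ),
    Filter.eventually_ge_atTop (2 * G)] with z hz hz6 hzG q c X hq hc0 hc hX
  have hz1 : 1 ≤ z := by linarith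
  have hq0 : 0 < q := hq ▸ exp_pos _
  have hX0 : 0 < X := lt_of_lt_of_le (by positivity) hX
  have hlogX : z ^ 70 / 2 ≤ log X := by
    rw [Real.le_log_iff_exp_le hX0]
    have : exp (z ^ 70 / 2) = q ^ 2 := by
      rw [hq, ← exp_nat_mul]; congr 1; push_cast; ring
    rw [this]; linarith [sq_nonneg q]
  have hz70 : z ≤ z ^ 70 := le_self_pow₀ hz1 (by norm_num)
  obtain ⟨r, hr, hr1, hr2⟩ := hG (log X) (by linarith)
  have hrz := pow_div_three_le_pow (Nat.cast_nonneg r) (by linarith : z ^ 70 ≤ 16 * (r : ℝ) ^ 200)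
  have hPE := pow_mul_le_exp (by linarith) hc0 hc
  have hq2 : 2 ≤ q := by
    have := add_one_le_exp (z ^ 70 / 4)
    linarith
  obtain ⟨h1, h2, h3, h4⟩ := bounds_of_pow_mul_le (H := 2 * z ^ 10)
    (by linarith [one_le_pow₀ (n := 10) hz1]) rfl
    (hPE.trans ((exp_pow_div_three_le (by linarith)).trans_eq hq.symm)) hq2 hX
  have h5 : z ^ 5 ≤ z ^ 10 := pow_le_pow_right₀ hz1 (by norm_num)
  exact ⟨h1, by linarith, h3, h4, r, hr, (mul_log_le_of_le hz1 (by linarith)).trans hrz,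
    hPE.trans (exp_le_exp.2 hrz), hr1, hr2⟩

/-- Any sufficiently large integer which is an almost square, i.e. `n = (N - a)(N + b)`
with `0 ≤ a ≤ b ≤ exp((log n)^(2/7))`, has at most eighteen divisors between
`√n - n^(1/4) (log n)^(1/14)` and `√n + n^(1/4) (log n)^(1/14)`. -/
theorem almost_square_few_middle_divisors :
    ∃ n₀ : ℕ, ∀ n : ℕ, n₀ ≤ n →
      (∃ N a b : ℤ, (n : ℤ) = (N - a) * (N + b) ∧ 0 ≤ a ∧ a ≤ b ∧
        (b : ℝ) ≤ Real.exp ((Real.log n) ^ ((2 : ℝ) / 7))) →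
      ((n.divisors.filter (fun (d : ℕ) =>
          Real.sqrt n - (n : ℝ) ^ ((1 : ℝ) / 4) * (Real.log n) ^ ((1 : ℝ) / 14) ≤ (d : ℝ) ∧
          (d : ℝ) ≤ Real.sqrt n + (n : ℝ) ^ ((1 : ℝ) / 4) * (Real.log n) ^ ((1 : ℝ) / 14))).card
        ≤ 18) := by
  have hz : Filter.Tendsto (fun n : ℕ => (log n) ^ ((1 : ℝ) / 70)) Filter.atTop Filter.atTop :=
    (tendsto_rpow_atTop (by norm_num)).comp
      (Real.tendsto_log_atTop.comp tendsto_natCast_atTop_atTop)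
  obtain ⟨n₀, hn₀⟩ := Filter.eventually_atTop.1 (hz.eventually eventually_exists_parameters)
  refine ⟨max n₀ 1, fun n hn ⟨N, a, b, hnab, ha, hab, hb⟩ => ?_⟩
  have hn1 : 1 ≤ n := (le_max_right _ _).trans hn
  have hnR : (1 : ℝ) ≤ n := by exact_mod_cast hn1
  have hl0 : 0 ≤ log n := log_nonneg hnR
  replace hn₀ := hn₀ n ((le_max_left _ _).trans hn)
  set z : ℝ := (log n) ^ ((1 : ℝ) / 70) with hzdef
  have hz0 : 0 ≤ z := by positivity
  have hzpow : ∀ k : ℕ, z ^ k = (log n) ^ ((k : ℝ) / 70) := fun k => by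
    rw [hzdef, ← rpow_natCast, ← rpow_mul hl0]; congr 1; ring
  have hz70 : log n = z ^ 70 := by rw [hzpow]; norm_num
  have hz20 : (log n) ^ ((2 : ℝ) / 7) = z ^ 20 := by rw [hzpow]; norm_num
  have hz5 : (log n) ^ ((1 : ℝ) / 14) = z ^ 5 := by rw [hzpow]; norm_num
  set q : ℝ := (n : ℝ) ^ ((1 : ℝ) / 4) with hq
  have hq0 : 0 < q := by positivity
  have hqexp : q = exp (z ^ 70 / 4) := by
    rw [hq, rpow_def_of_pos (by linarith), hz70]; congr 1; ring
  have hq4 : q ^ 4 = n := by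
    rw [hq, ← rpow_natCast, ← rpow_mul (by linarith)]; norm_num
  have hsqrt : √(n : ℝ) = q ^ 2 := by
    rw [← hq4, show q ^ 4 = (q ^ 2) ^ 2 by ring, sqrt_sq (by positivity)]
  rw [hz20] at hb
  rw [hz5, hsqrt]
  set c : ℕ := (a + b).natAbs with hcdef
  set S : ℕ := (2 * N + b - a).natAbs with hSdef
  have hS : S ^ 2 = 4 * n + c ^ 2 := by
    zify
    rw [hcdef, hSdef, Int.natCast_natAbs, Int.natCast_natAbs, sq_abs, sq_abs, hnab]
    ring
  have hSR : (S : ℝ) ^ 2 = 4 * q ^ 4 + (c : ℝ) ^ 2 := by rw [hq4]; exact_mod_cast hS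
  have hc : (c : ℝ) ≤ 2 * exp (z ^ 20) := by
    have h1 : (c : ℤ) ≤ 2 * b := by omega
    have h2 : (c : ℝ) ≤ 2 * b := by exact_mod_cast h1
    linarith
  have hX : 4 * q ^ 2 ≤ ((2 * S : ℕ) : ℝ) := by
    have : 2 * q ^ 2 ≤ S := by
      refine abs_le_of_sq_le_sq' ?_ (by positivity) |>.2
      rw [hSR]; nlinarith [sq_nonneg (c : ℝ)]
    push_cast; linarith
  have hX0 : 0 < 2 * S := by
    have : (0 : ℝ) < ((2 * S : ℕ) : ℝ) := lt_of_lt_of_le (by positivity) hX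
    exact_mod_cast this
  obtain ⟨hcq, hzq, hcX, hXH, r, hr, hW, hcH, hXr, hXr'⟩ :=
    hn₀ q c (2 * S : ℕ) hqexp (Nat.cast_nonneg c) hc hX
  set H : ℝ := 2 * z ^ 10 with hHdef
  by_contra! hcard
  set D := n.divisors.filter (fun (d : ℕ) => q ^ 2 - q * z ^ 5 ≤ (d : ℝ) ∧
    (d : ℝ) ≤ q ^ 2 + q * z ^ 5) with hD
  have hex : ∀ d ∈ D, ∃ h t : ℕ, d + n / d = S + h ∧ (h : ℝ) ≤ H ∧
      t ^ 2 = h * (2 * S) + h ^ 2 + c ^ 2 := by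
    intro d hd
    rw [hD, Finset.mem_filter, Nat.mem_divisors] at hd
    obtain ⟨h, t, h1, h2, h3⟩ :=
      exists_excess_of_dvd hS hq0 hq4 hcq hzq hd.1.1 hd.2.1 hd.2.2
    exact ⟨h, t, h1, by rw [hHdef]; linarith [show (z ^ 5) ^ 2 = z ^ 10 by ring], h3⟩
  set T := (D.image fun d => d + n / d - S).erase 0 with hT
  have hTcard : 5 ≤ T.card := by
    have h1 := Finset.card_le_mul_card_image (f := fun d => d + n / d - S) D 2 (fun k _ => by
      refine card_le_two_of_add_div_eq (n := n) (s := S + k) _ fun d hd => ?_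
      obtain ⟨hdD, hdk⟩ := Finset.mem_filter.1 hd
      obtain ⟨h, -, hh, -⟩ := hex d hdD
      rw [hD, Finset.mem_filter] at hdD
      exact ⟨Nat.pos_of_mem_divisors hdD.1, Nat.dvd_of_mem_divisors hdD.1, by omega⟩)
    have h2 : (D.image fun d => d + n / d - S).card - 1 ≤ T.card := Finset.pred_card_le_card_erase
    omega
  have hTpos : ∀ h ∈ T, 0 < h := fun h hh => Nat.pos_of_ne_zero (Finset.ne_of_mem_erase hh)
  have hTex : ∀ h ∈ T, (h : ℝ) ≤ H ∧ ∃ t : ℕ, t ^ 2 = h * (2 * S) + h ^ 2 + c ^ 2 := by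
    intro h hh
    obtain ⟨d, hd, rfl⟩ := Finset.mem_image.1 (Finset.mem_of_mem_erase hh)
    obtain ⟨h, t, h1, h2, h3⟩ := hex d hd
    rw [h1, Nat.add_sub_cancel_left]
    exact ⟨h2, t, h3⟩
  obtain ⟨x, hx, y, hy, u, hu, hxy, hxu, hyu⟩ := exists_three_not_isSquare_mul hTcard hTpos
    fun x hx y hy hne hsq => by
      obtain ⟨hxH, s, hs⟩ := hTex x hx
      obtain ⟨hyH, t, ht⟩ := hTex y hy
      exact mul_eq_sq_of_isSquare (hTpos x hx) (hTpos y hy) hs ht hxH hyH hcX hXH hne hsq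
  obtain ⟨hxH, s, hs⟩ := hTex x hx
  obtain ⟨hyH, t, ht⟩ := hTex y hy
  obtain ⟨huH, v, hv⟩ := hTex u hu
  exact false_of_three_squares (hTpos x hx) (hTpos y hy) (hTpos u hu) hs ht hv hxy hxu hyu
    hxH hyH huH hr hW hcH hXH hX0 hXr hXr'
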